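/- Let g: ℝ³×ℝ → ℂ be a smooth K'-invariant function. Then there exists a smooth SO(3)-invariant function f: ℝ³×ℝ³ → ℂ with f(x,(0,0,t)) = g(x,t) for all x∈ℝ³, t∈ℝ, if and only if g satisfies Property (R): for every M∈ℕ there exists a function P_M: ℝ³×ℝ³ → ℂ which is SO(3)-invariant, is for each fixed x a homogeneous polynomial of degree M in y whose coefficients are smooth functions of x, and satisfies P_M(x,(0,0,t)) = (1/M!)·(∂_t^M g)(x,0)·t^M for all x,t. Moreover, in this case, if g is in addition a Schwartz function, then f can be chosen to be a Schwartz SO(3)-invariant function. -/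

import Mathlib

open MeasureTheory Complex Matrix

noncomputable section

abbrev V3 := Fin 3 → ℝ
abbrev Mat3 := Matrix (Fin 3) (Fin 3) ℝ

instance : MeasurableSpace Mat3 := (inferInstance : MeasurableSpace (Fin 3 → Fin 3 → ℝ))

/-- The set of special orthogonal 3×3 real matrices. -/
def SO3 : Set Mat3 := {A | A * A.transpose = 1 ∧ A.det = 1}

/-- `SO(3)`-invariance of a function on `ℝ³ × ℝ³` (simultaneous action on both factors). -/
def Inv3 (F : V3 × V3 → ℂ) : Prop :=
  ∀ k ∈ SO3, ∀ x y : V3, F (k.mulVec x, k.mulVec y) = F (x, y)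

/-- The orthogonal group `O(2)` as a set of 2×2 matrices. -/
def O2 : Set (Matrix (Fin 2) (Fin 2) ℝ) := {A | A * A.transpose = 1}

/-- The action of `A ∈ O(2)` on `ℝ³ × ℝ`:
`A·(x₁,x₂,x₃,t) = (A(x₁,x₂), (det A)x₃, (det A)t)`. -/
def KAct (A : Matrix (Fin 2) (Fin 2) ℝ) (p : (Fin 3 → ℝ) × ℝ) : (Fin 3 → ℝ) × ℝ :=
  (![A.mulVec ![p.1 0, p.1 1] 0, A.mulVec ![p.1 0, p.1 1] 1, A.det * p.1 2], A.det * p.2)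

/-- `K'`-invariance of a function on `ℝ³ × ℝ`. -/
def InvK' (G : (Fin 3 → ℝ) × ℝ → ℂ) : Prop := ∀ A ∈ O2, ∀ p, G (KAct A p) = G p


/-- Property (R): for every `M` the `M`-th Taylor coefficient of `g` in `t` at `t = 0`
radialises to an `SO(3)`-invariant function on `ℝ³ × ℝ³` which is a homogeneous polynomial
of degree `M` in `y` with smooth coefficients in `x`. -/
def PropertyR (g : V3 × ℝ → ℂ) : Prop :=
  ∀ M : ℕ, ∃ P : V3 × V3 → ℂ,
    Inv3 P ∧
    (∃ c : ℕ × ℕ × ℕ → (V3 → ℂ),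
      (∀ m, ContDiff ℝ (⊤ : ℕ∞) (c m)) ∧
      ∀ x y : V3, P (x, y) =
        ∑ m ∈ (Finset.range (M + 1) ×ˢ Finset.range (M + 1) ×ˢ Finset.range (M + 1)).filter
            (fun m => m.1 + m.2.1 + m.2.2 = M),
          c m x * (y 0 : ℂ) ^ m.1 * (y 1 : ℂ) ^ m.2.1 * (y 2 : ℂ) ^ m.2.2) ∧
    (∀ (x : V3) (t : ℝ),
      P (x, ![0, 0, t]) = (M.factorial : ℂ)⁻¹ * deriv^[M] (fun s => g (x, s)) 0 * (t : ℂ) ^ M)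


open scoped SchwartzMap ContDiff

section Generic
variable {D E F G H : Type} [NormedAddCommGroup D] [NormedSpace ℝ D]
  [NormedAddCommGroup E] [NormedSpace ℝ E]
  [NormedAddCommGroup F] [NormedSpace ℝ F] [NormedAddCommGroup G] [NormedSpace ℝ G]
  [NormedAddCommGroup H] [NormedSpace ℝ H]

theorem tensorS (φ : 𝓢(E, F)) (b : D → ℝ) (hb : HasCompactSupport b) (hbs : ContDiff ℝ ∞ b) :
    ∃ ψ : 𝓢(E × D, F), ∀ p, ψ p = b p.2 • φ p.1 := by
  let bS : 𝓢(D, ℝ) := hb.toSchwartzMap hbs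
  have hs1 : ContDiff ℝ ∞ (fun p : E × D => b p.2) := hbs.comp contDiff_snd
  have hs2 : ContDiff ℝ ∞ (fun p : E × D => φ p.1) := (φ.smooth ⊤).comp contDiff_fst
  refine ⟨⟨fun p => b p.2 • φ p.1, hs1.smul hs2, ?_⟩, fun p => rfl⟩
  intro k n
  have h1 : ∀ i (p : E × D), ‖iteratedFDeriv ℝ i (fun p : E × D => b p.2) p‖
      ≤ ‖iteratedFDeriv ℝ i b p.2‖ := by
    intro i p
    have := ContinuousLinearMap.iteratedFDeriv_comp_right (ContinuousLinearMap.snd ℝ E D) hbs p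
      (i := i) (by exact_mod_cast le_top)
    have e : (fun p : E × D => b p.2) = b ∘ (ContinuousLinearMap.snd ℝ E D) := rfl
    rw [e, this]
    refine (ContinuousMultilinearMap.norm_compContinuousLinearMap_le _ _).trans ?_
    refine mul_le_of_le_one_right (norm_nonneg _) ?_
    refine Finset.prod_le_one (fun _ _ => norm_nonneg _) (fun _ _ => ContinuousLinearMap.norm_snd_le ..)
  have h2 : ∀ i (p : E × D), ‖iteratedFDeriv ℝ i (fun p : E × D => φ p.1) p‖
      ≤ ‖iteratedFDeriv ℝ i φ p.1‖ := by
    intro i p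
    have := ContinuousLinearMap.iteratedFDeriv_comp_right (ContinuousLinearMap.fst ℝ E D) (φ.smooth ⊤) p
      (i := i) (by exact_mod_cast le_top)
    have e : (fun p : E × D => φ p.1) = φ ∘ (ContinuousLinearMap.fst ℝ E D) := rfl
    rw [e, this]
    refine (ContinuousMultilinearMap.norm_compContinuousLinearMap_le _ _).trans ?_
    refine mul_le_of_le_one_right (norm_nonneg _) ?_
    refine Finset.prod_le_one (fun _ _ => norm_nonneg _) (fun _ _ => ContinuousLinearMap.norm_fst_le ..)
  choose Cb hCb using fun i k => bS.decay k i
  choose Cf hCf using fun i k => φ.decay k i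
  refine ⟨∑ i ∈ Finset.range (n + 1), (n.choose i : ℝ) * (2 ^ k *
    (Cb i k * Cf (n - i) 0 + Cb i 0 * Cf (n - i) k)), fun p => ?_⟩
  have := norm_iteratedFDeriv_smul_le hs1 hs2 p (n := n) (by exact_mod_cast le_top)
  refine (mul_le_mul_of_nonneg_left this (by positivity)).trans ?_
  rw [Finset.mul_sum]
  refine Finset.sum_le_sum fun i _ => ?_
  have hb0 := (hCb i 0).2 p.2
  have hbk := (hCb i k).2 p.2
  have hf0 := (hCf (n - i) 0).2 p.1
  have hfk := (hCf (n - i) k).2 p.1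
  have hbS : ∀ j, iteratedFDeriv ℝ j (⇑bS) = iteratedFDeriv ℝ j b := fun j => rfl
  rw [hbS] at hb0 hbk
  have hk : ‖p‖ ^ k ≤ 2 ^ k * (‖p.2‖ ^ k + ‖p.1‖ ^ k) := by
    have h0 : ‖p‖ ^ k ≤ ‖p.2‖ ^ k + ‖p.1‖ ^ k := by
      rcases le_total ‖p.1‖ ‖p.2‖ with h | h
      · rw [Prod.norm_def, max_eq_right h]; have := pow_nonneg (norm_nonneg p.1) k; linarith
      · rw [Prod.norm_def, max_eq_left h]; have := pow_nonneg (norm_nonneg p.2) k; linarith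
    refine h0.trans (le_mul_of_one_le_left (by positivity) (one_le_pow₀ (by norm_num)))
  set A := ‖iteratedFDeriv ℝ i b p.2‖
  set B := ‖iteratedFDeriv ℝ (n - i) φ p.1‖
  have hA : 0 ≤ A := norm_nonneg _
  have hB : 0 ≤ B := norm_nonneg _
  simp only [pow_zero, one_mul] at hb0 hf0
  have e1 : ‖iteratedFDeriv ℝ i (fun p : E × D => b p.2) p‖ *
      ‖iteratedFDeriv ℝ (n - i) (fun p : E × D => φ p.1) p‖ ≤ A * B :=
    mul_le_mul (h1 i p) (h2 _ p) (norm_nonneg _) hA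
  calc ‖p‖ ^ k * ((n.choose i : ℝ) * ‖iteratedFDeriv ℝ i (fun p : E × D => b p.2) p‖ *
      ‖iteratedFDeriv ℝ (n - i) (fun p : E × D => φ p.1) p‖)
      = (n.choose i : ℝ) * (‖p‖ ^ k * (‖iteratedFDeriv ℝ i (fun p : E × D => b p.2) p‖ *
      ‖iteratedFDeriv ℝ (n - i) (fun p : E × D => φ p.1) p‖)) := by ring
    _ ≤ (n.choose i : ℝ) * ((2 ^ k * (‖p.2‖ ^ k + ‖p.1‖ ^ k)) * (A * B)) := by gcongr
    _ = (n.choose i : ℝ) * (2 ^ k * ((‖p.2‖ ^ k * A) * B + A * (‖p.1‖ ^ k * B))) := by ring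
    _ ≤ _ := by
      gcongr
      · exact le_trans (by positivity) hbk
      · exact le_trans hA hb0

/-- flatness of order `m` on a set -/
def Fl (Z : Set E) (m : ℕ) (h : E → F) : Prop := ∀ j < m, ∀ p ∈ Z, iteratedFDeriv ℝ j h p = 0

theorem Fl.mono {Z : Set E} {m n : ℕ} {h : E → F} (hh : Fl Z m h) (hn : n ≤ m) : Fl Z n h :=
  fun j hj => hh j (by omega)

theorem Fl.eq_zero {Z : Set E} {m : ℕ} {h : E → F} (hh : Fl Z m h) (hm : 0 < m) (p : E) (hp : p ∈ Z) :
    h p = 0 := by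
  have := hh 0 hm p hp
  rw [← norm_eq_zero, ← norm_iteratedFDeriv_zero (𝕜 := ℝ), this, norm_zero]

theorem Fl.fderiv {Z : Set E} {m : ℕ} {h : E → F} (hh : Fl Z (m + 1) h) : Fl Z m (fderiv ℝ h) := by
  intro j hj p hp
  rw [← norm_eq_zero, norm_iteratedFDeriv_fderiv, hh (j + 1) (by omega) p hp, norm_zero]

theorem Fl.of_fderiv {Z : Set E} {m : ℕ} {h : E → F} (h0 : ∀ p ∈ Z, h p = 0)
    (hh : Fl Z m (_root_.fderiv ℝ h)) : Fl Z (m + 1) h := by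
  intro j hj p hp
  rw [← norm_eq_zero]
  cases j with
  | zero => rw [norm_iteratedFDeriv_zero, h0 p hp, norm_zero]
  | succ j => rw [← norm_iteratedFDeriv_fderiv, hh j (by omega) p hp, norm_zero]

theorem Fl.add {Z : Set E} {m : ℕ} {f g : E → F} (hf : ContDiff ℝ ∞ f) (hg : ContDiff ℝ ∞ g)
    (h1 : Fl Z m f) (h2 : Fl Z m g) : Fl Z m (fun p => f p + g p) := by
  intro j hj p hp
  have := iteratedFDeriv_add_apply (𝕜 := ℝ) (i := j) (x := p) (f := f) (g := g)
    (hf.contDiffAt.of_le (by exact_mod_cast le_top)) (hg.contDiffAt.of_le (by exact_mod_cast le_top))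
  have e : (fun p => f p + g p) = f + g := rfl
  rw [e, this, h1 j hj p hp, h2 j hj p hp, add_zero]

theorem Fl.bilin {Z : Set E} {m : ℕ} {f : E → F} {g : E → G} (B : F →L[ℝ] G →L[ℝ] H)
    (hf : ContDiff ℝ ∞ f) (hg : ContDiff ℝ ∞ g)
    (h1 : Fl Z m f) : Fl Z m (fun p => B (f p) (g p)) := by
  intro j hj p hp
  have := B.norm_iteratedFDeriv_le_of_bilinear hf hg p (n := j) (by exact_mod_cast le_top)
  rw [← norm_eq_zero]
  refine le_antisymm (this.trans (le_of_eq ?_)) (norm_nonneg _)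
  rw [Finset.sum_eq_zero, mul_zero]
  intro i hi
  rw [h1 i (by simp at hi; omega) p hp]; simp

theorem Fl.comp {Z : Set E} {Z' : Set D} {m : ℕ} {h : E → F} {φ : D → E}
    (hh : ContDiff ℝ ∞ h) (hφ : ContDiff ℝ ∞ φ) (hm : ∀ p ∈ Z', φ p ∈ Z) (h1 : Fl Z m h) :
    Fl Z' m (fun p => h (φ p)) := by
  intro j hj p hp
  have := norm_iteratedFDeriv_comp_le hh hφ (n := j) (by exact_mod_cast le_top) p (C := 0)
    (D := 1 + ∑ i ∈ Finset.range (j + 1), ‖iteratedFDeriv ℝ i φ p‖)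
    (fun i hi => by rw [h1 i (by omega) _ (hm p hp), norm_zero])
    (fun i hi hi' => by
      have h2 : ‖iteratedFDeriv ℝ i φ p‖ ≤ ∑ i ∈ Finset.range (j + 1), ‖iteratedFDeriv ℝ i φ p‖ :=
        Finset.single_le_sum (f := fun i => ‖iteratedFDeriv ℝ i φ p‖)
          (fun _ _ => norm_nonneg _) (by simp; omega)
      have h3 : (1 : ℝ) ≤ 1 + ∑ i ∈ Finset.range (j + 1), ‖iteratedFDeriv ℝ i φ p‖ := by
        have : 0 ≤ ∑ i ∈ Finset.range (j + 1), ‖iteratedFDeriv ℝ i φ p‖ :=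
          Finset.sum_nonneg fun _ _ => norm_nonneg _
        linarith
      have h4 := le_self_pow₀ h3 (show i ≠ 0 by omega)
      linarith)
  rw [← norm_eq_zero]
  refine le_antisymm (this.trans (le_of_eq ?_)) (norm_nonneg _)
  ring

end Generic

abbrev EE := (V3 × ℝ) × V3
def ZE : Set EE := {p | p.1.2 = 0}

theorem flat_bound (m : ℕ) : ∀ {F : Type} [NormedAddCommGroup F] [NormedSpace ℝ F] (h : 𝓢(EE, F)),
    Fl ZE m h → ∀ k : ℕ, ∃ C : ℝ, ∀ p : EE, ‖p‖ ^ k * ‖h p‖ ≤ C * |p.1.2| ^ m := by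
  induction m with
  | zero =>
    intro F _ _ h _ k
    obtain ⟨C, -, hC⟩ := h.decay k 0
    exact ⟨C, fun p => by simpa using hC p⟩
  | succ m ih =>
    intro F _ _ h hf k
    obtain ⟨C2, hC2p, hC2⟩ := h.decay k 0
    have hf' : Fl ZE m (SchwartzMap.fderivCLM ℝ EE F h) := by
      have : ⇑(SchwartzMap.fderivCLM ℝ EE F h) = fderiv ℝ h := by
        ext1 p; rw [SchwartzMap.fderivCLM_apply]
      rw [this]; exact hf.fderiv
    obtain ⟨C1, hC1⟩ := ih _ hf' k
    obtain ⟨C0, hC0⟩ := ih _ hf' 0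
    simp only [SchwartzMap.fderivCLM_apply, pow_zero, one_mul] at hC1 hC0
    set K := 2 ^ k * (|C1| + |C0|) with hK
    have hKp : 0 ≤ K := by positivity
    refine ⟨C2 + K, fun p => ?_⟩
    have h2 : ‖p‖ ^ k * ‖h p‖ ≤ C2 := by simpa using hC2 p
    rcases le_or_gt 1 |p.1.2| with hs | hs
    · have : 1 ≤ |p.1.2| ^ (m + 1) := one_le_pow₀ hs
      nlinarith
    · set p0 : EE := ((p.1.1, 0), p.2) with hp0
      have hseg : ∀ q ∈ segment ℝ p0 p, ‖p0‖ ≤ ‖q‖ ∧ |q.1.2| ≤ |p.1.2| := by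
        intro q hq
        obtain ⟨a, b, ha, hb, hab, rfl⟩ := hq
        have e1 : (a • p0 + b • p) = ((p.1.1, b * p.1.2), p.2) := by
          ext i
          · simp [hp0]; rw [← add_mul, hab, one_mul]
          · simp [hp0]
          · simp [hp0]; rw [← add_mul, hab, one_mul]
        rw [e1]
        constructor
        · simp only [hp0, Prod.norm_def, norm_zero]
          gcongr
          exact norm_nonneg _
        · simp only [abs_mul, abs_of_nonneg hb]
          exact mul_le_of_le_one_left (abs_nonneg _) (by linarith)
      have hpn : ‖p‖ ≤ ‖p0‖ + 1 := by
        have : p = p0 + ((0, p.1.2), 0) := by ext i <;> simp [hp0]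
        calc ‖p‖ ≤ ‖p0‖ + ‖(((0, p.1.2), 0) : EE)‖ :=
            (congrArg norm this).le.trans (norm_add_le _ _)
          _ ≤ _ := by
            gcongr
            simp [Prod.norm_def]; exact hs.le
      have hder : ∀ q ∈ segment ℝ p0 p, ‖fderiv ℝ h q‖ ≤ K * |p.1.2| ^ m / (‖p0‖ + 1) ^ k := by
        intro q hq
        obtain ⟨hq1, hq2⟩ := hseg q hq
        rw [le_div_iff₀ (by positivity)]
        have a1 : (‖p0‖ + 1) ^ k ≤ 2 ^ k * (‖q‖ ^ k + 1) := by
          have : ‖p0‖ + 1 ≤ 2 * max ‖q‖ 1 := by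
            have := le_max_left ‖q‖ 1; have := le_max_right ‖q‖ 1; linarith
          calc (‖p0‖ + 1) ^ k ≤ (2 * max ‖q‖ 1) ^ k := by gcongr
            _ = 2 ^ k * (max ‖q‖ 1) ^ k := mul_pow _ _ _
            _ ≤ _ := by
              gcongr
              rcases le_total ‖q‖ 1 with h | h
              · rw [max_eq_right h]; simp
              · rw [max_eq_left h]; simp
        have a2 : |q.1.2| ^ m ≤ |p.1.2| ^ m := by gcongr
        have b1 := hC1 q
        have b0 := hC0 q
        have c1 : ‖q‖ ^ k * ‖fderiv ℝ h q‖ ≤ |C1| * |p.1.2| ^ m :=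
          b1.trans (mul_le_mul (le_abs_self _) a2 (by positivity) (abs_nonneg _))
        have c0 : ‖fderiv ℝ h q‖ ≤ |C0| * |p.1.2| ^ m :=
          b0.trans (mul_le_mul (le_abs_self _) a2 (by positivity) (abs_nonneg _))
        calc ‖fderiv ℝ h q‖ * (‖p0‖ + 1) ^ k ≤ ‖fderiv ℝ h q‖ * (2 ^ k * (‖q‖ ^ k + 1)) := by gcongr
          _ = 2 ^ k * (‖q‖ ^ k * ‖fderiv ℝ h q‖ + ‖fderiv ℝ h q‖) := by ring
          _ ≤ 2 ^ k * (|C1| * |p.1.2| ^ m + |C0| * |p.1.2| ^ m) := by gcongr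
          _ = _ := by rw [hK]; ring
      have hmv := (convex_segment p0 p).norm_image_sub_le_of_norm_fderiv_le (𝕜 := ℝ)
        (fun q _ => h.differentiableAt) hder (left_mem_segment ℝ p0 p) (right_mem_segment ℝ p0 p)
      have hz : h p0 = 0 := hf.eq_zero (by omega) p0 (by simp [ZE, hp0])
      have hd : ‖p - p0‖ = |p.1.2| := by
        simp [hp0, Prod.norm_def]
      rw [hz, sub_zero, hd] at hmv
      calc ‖p‖ ^ k * ‖h p‖ ≤ (‖p0‖ + 1) ^ k * (K * |p.1.2| ^ m / (‖p0‖ + 1) ^ k * |p.1.2|) := by gcongr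
        _ = K * |p.1.2| ^ (m + 1) := by field_simp; ring
        _ ≤ _ := by
          have : 0 ≤ |p.1.2| ^ (m + 1) := by positivity
          nlinarith

def dotL : V3 →L[ℝ] V3 →L[ℝ] ℝ :=
  ∑ i : Fin 3, (ContinuousLinearMap.proj (R := ℝ) (φ := fun _ : Fin 3 => ℝ) i).smulRight
    (ContinuousLinearMap.proj (R := ℝ) (φ := fun _ : Fin 3 => ℝ) i)

theorem dotL_apply (x y : V3) : dotL x y = x 0 * y 0 + x 1 * y 1 + x 2 * y 2 := by
  simp [dotL, Fin.sum_univ_three]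

def nrm (y : V3) : ℝ := √(y 0 ^ 2 + y 1 ^ 2 + y 2 ^ 2)

theorem nrm_nonneg (y : V3) : 0 ≤ nrm y := Real.sqrt_nonneg _
theorem nrm_sq (y : V3) : nrm y ^ 2 = y 0 ^ 2 + y 1 ^ 2 + y 2 ^ 2 := Real.sq_sqrt (by positivity)
theorem norm_le_nrm (y : V3) : ‖y‖ ≤ nrm y := by
  rw [pi_norm_le_iff_of_nonneg (nrm_nonneg y)]
  intro i
  rw [Real.norm_eq_abs]
  apply Real.abs_le_sqrt
  fin_cases i <;> simp <;> nlinarith [sq_nonneg (y 0), sq_nonneg (y 1), sq_nonneg (y 2)]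
theorem nrm_le_norm (y : V3) : nrm y ≤ 2 * ‖y‖ := by
  have h : ∀ i, y i ^ 2 ≤ ‖y‖ ^ 2 := fun i => by
    have := norm_le_pi_norm y i
    rw [Real.norm_eq_abs] at this
    exact sq_le_sq' (by linarith [neg_abs_le (y i)]) (by linarith [le_abs_self (y i)])
  apply Real.sqrt_le_iff.2
  refine ⟨by positivity, ?_⟩
  nlinarith [h 0, h 1, h 2]
theorem nrm_zero : nrm 0 = 0 := by simp [nrm]
theorem nrm_pos {y : V3} (hy : y ≠ 0) : 0 < nrm y := (norm_pos_iff.2 hy).trans_le (norm_le_nrm y)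

theorem nrm_hasFDerivAt {y : V3} (hy : y ≠ 0) : HasFDerivAt nrm (dotL ((nrm y)⁻¹ • y)) y := by
  have h1 : HasFDerivAt (fun y : V3 => dotL y y) ((2 : ℝ) • dotL y) y := by
    have := dotL.hasFDerivAt_of_bilinear (hasFDerivAt_id y) (hasFDerivAt_id y)
    refine this.congr_fderiv ?_
    ext v
    simp [dotL_apply]; ring
  have e : nrm = fun y => √(dotL y y) := by
    funext y; simp only [nrm, dotL_apply]; congr 1; ring
  have h2 : dotL y y = nrm y ^ 2 := by rw [nrm_sq, dotL_apply]; ring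
  have hp := nrm_pos hy
  have h3 := h1.sqrt (by rw [h2]; positivity)
  rw [← e] at h3
  refine h3.congr_fderiv ?_
  rw [h2, Real.sqrt_sq hp.le, smul_smul, map_smul]
  congr 1
  field_simp

def prj (z : V3 × V3) : EE := ((z.1, nrm z.2), (nrm z.2)⁻¹ • z.2)

theorem norm_le_prj (z : V3 × V3) : ‖z‖ ≤ ‖prj z‖ := by
  rw [Prod.norm_def]
  refine max_le ?_ ?_
  · exact (norm_fst_le (prj z).1).trans (norm_fst_le (prj z))
  · have h1 : |nrm z.2| ≤ ‖prj z‖ := (norm_snd_le (prj z).1).trans (norm_fst_le (prj z))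
    exact (norm_le_nrm _).trans ((le_abs_self _).trans h1)

def ellM (p : EE) : V3 × V3 →L[ℝ] ℝ := (dotL p.2).comp (ContinuousLinearMap.snd ℝ V3 V3)

def Lmap (p : EE) : V3 × V3 →L[ℝ] EE :=
  ((p.1.2 • ContinuousLinearMap.fst ℝ V3 V3).prod (p.1.2 • ellM p)).prod
    (ContinuousLinearMap.snd ℝ V3 V3 - (ellM p).smulRight p.2)

theorem ellM_temp : Function.HasTemperateGrowth ellM := by
  let A : EE →L[ℝ] (V3 × V3 →L[ℝ] ℝ) :=
    (((ContinuousLinearMap.compL ℝ (V3 × V3) V3 ℝ).flip (ContinuousLinearMap.snd ℝ V3 V3)).comp dotL).comp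
      (ContinuousLinearMap.snd ℝ (V3 × ℝ) V3)
  have : ellM = A := by funext p; ext1 <;> rfl
  rw [this]
  exact A.hasTemperateGrowth

theorem Lmap_temp : Function.HasTemperateGrowth Lmap := by
  let i1 : V3 →L[ℝ] EE := (ContinuousLinearMap.inl ℝ (V3 × ℝ) V3).comp (ContinuousLinearMap.inl ℝ V3 ℝ)
  let i2 : ℝ →L[ℝ] EE := (ContinuousLinearMap.inl ℝ (V3 × ℝ) V3).comp (ContinuousLinearMap.inr ℝ V3 ℝ)
  let i3 : V3 →L[ℝ] EE := ContinuousLinearMap.inr ℝ (V3 × ℝ) V3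
  have e : Lmap = fun p => p.1.2 • i1.comp (ContinuousLinearMap.fst ℝ V3 V3) +
      p.1.2 • (ContinuousLinearMap.compL ℝ (V3 × V3) ℝ EE i2) (ellM p) +
      i3.comp (ContinuousLinearMap.snd ℝ V3 V3) -
      (ContinuousLinearMap.smulRightL ℝ (V3 × V3) EE) (ellM p) (i3 p.2) := by
    funext p
    ext v i <;> simp [Lmap, i1, i2, i3]
  rw [e]
  have hs : Function.HasTemperateGrowth (fun p : EE => p.1.2) :=
    ((ContinuousLinearMap.snd ℝ V3 ℝ).comp (ContinuousLinearMap.fst ℝ (V3 × ℝ) V3)).hasTemperateGrowth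
  have hu : Function.HasTemperateGrowth (fun p : EE => i3 p.2) :=
    (i3.comp (ContinuousLinearMap.snd ℝ (V3 × ℝ) V3)).hasTemperateGrowth
  have h2 : Function.HasTemperateGrowth
      (fun p : EE => (ContinuousLinearMap.compL ℝ (V3 × V3) ℝ EE i2) (ellM p)) :=
    (ContinuousLinearMap.hasTemperateGrowth _).comp ellM_temp
  exact (((hs.smul (.const _)).add (hs.smul h2)).add (.const _)).sub
    (ContinuousLinearMap.bilinear_hasTemperateGrowth (𝕜 := ℝ) _ ellM_temp hu)

theorem prj_hasFDerivAt {z : V3 × V3} (hz : z.2 ≠ 0) :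
    HasFDerivAt prj ((nrm z.2)⁻¹ • Lmap (prj z)) z := by
  have hp := nrm_pos hz
  have hn : HasFDerivAt (fun z : V3 × V3 => nrm z.2) (ellM (prj z)) z :=
    (nrm_hasFDerivAt hz).comp z hasFDerivAt_snd
  have hi := (hasDerivAt_inv hp.ne').comp_hasFDerivAt z hn
  have h1 : HasFDerivAt (fun z : V3 × V3 => (nrm z.2)⁻¹ • z.2) _ z := hi.smul hasFDerivAt_snd
  have h := (hasFDerivAt_fst.prodMk hn).prodMk h1
  refine h.congr_fderiv ?_
  ext v i
  · simp [Lmap, prj, ellM]; field_simp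
  · simp [Lmap, prj, ellM]
  · simp [Lmap, prj, ellM]
  · simp [Lmap, prj, ellM]
  · simp [Lmap, prj, ellM, hp.ne']
  · simp [Lmap, prj, ellM]; field_simp; ring

def GG {F : Type} [NormedAddCommGroup F] [NormedSpace ℝ F] (N : ℕ) (h : EE → F) (z : V3 × V3) : F :=
  ((nrm z.2)⁻¹) ^ N • h (prj z)

section
variable {F : Type} [NormedAddCommGroup F] [NormedSpace ℝ F]

theorem bilin_contDiff {E G H : Type} [NormedAddCommGroup E] [NormedSpace ℝ E]
    [NormedAddCommGroup G] [NormedSpace ℝ G] [NormedAddCommGroup H] [NormedSpace ℝ H]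
    (B : F →L[ℝ] G →L[ℝ] H) {f : E → F} {g : E → G} (hf : ContDiff ℝ ∞ f) (hg : ContDiff ℝ ∞ g) :
    ContDiff ℝ ∞ (fun p => B (f p) (g p)) :=
  (B.contDiff.comp hf).clm_apply hg

theorem exists_T (N m : ℕ) (h : 𝓢(EE, F)) (hf : Fl ZE (m + 1) h) :
    ∃ h' : 𝓢(EE, V3 × V3 →L[ℝ] F), Fl ZE m h' ∧
      ∀ p, h' p = (fderiv ℝ h p).comp (Lmap p) - (N : ℝ) • (ellM p).smulRight (h p) := by
  let B1 := ContinuousLinearMap.compL ℝ (V3 × V3) EE F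
  let B2 : F →L[ℝ] (V3 × V3 →L[ℝ] ℝ) →L[ℝ] (V3 × V3 →L[ℝ] F) :=
    (-(N : ℝ)) • (ContinuousLinearMap.smulRightL ℝ (V3 × V3) F).flip
  let h1 := SchwartzMap.bilinLeftCLM B1 Lmap_temp (SchwartzMap.fderivCLM ℝ EE F h)
  let h2 := SchwartzMap.bilinLeftCLM B2 ellM_temp h
  have e : ∀ p, (h1 + h2) p = B1 (fderiv ℝ h p) (Lmap p) + B2 (h p) (ellM p) := by
    intro p
    simp [h1, h2, SchwartzMap.bilinLeftCLM_apply, SchwartzMap.fderivCLM_apply]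
  refine ⟨h1 + h2, ?_, ?_⟩
  · have : ⇑(h1 + h2) = fun p => B1 (fderiv ℝ h p) (Lmap p) + B2 (h p) (ellM p) := funext e
    rw [this]
    have hd : ContDiff ℝ ∞ (fderiv ℝ h) := by
      have := (SchwartzMap.fderivCLM ℝ EE F h).smooth ⊤
      have e : ⇑(SchwartzMap.fderivCLM ℝ EE F h) = fderiv ℝ h := by
        ext1 p; rw [SchwartzMap.fderivCLM_apply]
      rwa [e] at this
    refine Fl.add ?_ ?_ (Fl.bilin B1 hd Lmap_temp.1 hf.fderiv)
      (Fl.bilin B2 (h.smooth ⊤) ellM_temp.1 (hf.mono (by omega)))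
    · exact bilin_contDiff B1 hd Lmap_temp.1
    · exact bilin_contDiff B2 (h.smooth ⊤) ellM_temp.1
  · intro p
    rw [e]
    apply ContinuousLinearMap.ext; intro v; simp [B1, B2]; abel

theorem GG_bound (N j : ℕ) (h : 𝓢(EE, F)) (hf : Fl ZE (N + j) h) (k : ℕ) :
    ∃ C, ∀ z, z.2 ≠ 0 → ‖z‖ ^ k * ‖GG N h z‖ ≤ C * nrm z.2 ^ j := by
  obtain ⟨C, hC⟩ := flat_bound _ h hf k
  refine ⟨C, fun z hz => ?_⟩
  have hp := nrm_pos hz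
  have h1 := hC (prj z)
  have h2 : |(prj z).1.2| = nrm z.2 := abs_of_nonneg hp.le
  rw [h2, pow_add] at h1
  have h3 : ‖z‖ ^ k * ‖h (prj z)‖ ≤ C * (nrm z.2 ^ N * nrm z.2 ^ j) := by
    refine le_trans ?_ h1
    gcongr
    exact norm_le_prj z
  rw [GG, norm_smul, norm_pow, norm_inv, Real.norm_of_nonneg hp.le, inv_pow]
  calc ‖z‖ ^ k * ((nrm z.2 ^ N)⁻¹ * ‖h (prj z)‖) = (nrm z.2 ^ N)⁻¹ * (‖z‖ ^ k * ‖h (prj z)‖) := by ring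
    _ ≤ (nrm z.2 ^ N)⁻¹ * (C * (nrm z.2 ^ N * nrm z.2 ^ j)) := by gcongr
    _ = _ := by field_simp

theorem GG_zero (N : ℕ) (h : EE → F) (m : ℕ) (hm : 0 < m) (hf : Fl ZE m h) (z : V3 × V3) (hz : z.2 = 0) :
    GG N h z = 0 := by
  have : h (prj z) = 0 := hf.eq_zero hm _ (by simp [ZE, prj, hz, nrm_zero])
  rw [GG, this, smul_zero]

theorem GG_bound' (N j : ℕ) (h : 𝓢(EE, F)) (hf : Fl ZE (N + (j + 1)) h) (k : ℕ) :
    ∃ C, 0 ≤ C ∧ ∀ z, ‖z‖ ^ k * ‖GG N h z‖ ≤ C * nrm z.2 ^ j := by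
  obtain ⟨C, hC⟩ := GG_bound N j h (hf.mono (by omega)) k
  refine ⟨|C|, abs_nonneg _, fun z => ?_⟩
  have := pow_nonneg (nrm_nonneg z.2) j
  by_cases hz : z.2 = 0
  · rw [GG_zero N h _ (by omega) hf z hz]; simp; positivity
  · exact (hC z hz).trans (by gcongr; exact le_abs_self _)

theorem GG_hasFDerivAt (N : ℕ) (h : 𝓢(EE, F)) (hf : Fl ZE (N + 3) h)
    (h' : EE → V3 × V3 →L[ℝ] F)
    (hh' : ∀ p, h' p = (fderiv ℝ h p).comp (Lmap p) - (N : ℝ) • (ellM p).smulRight (h p))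
    (z : V3 × V3) : HasFDerivAt (GG N h) (GG (N + 1) h' z) z := by
  by_cases hz : z.2 = 0
  · have h0 : GG (N + 1) h' z = 0 := by simp [GG, hz, nrm_zero]
    rw [h0]
    obtain ⟨C, hCp, hC⟩ := GG_bound' N 2 h hf 0
    have hz0 := GG_zero N h _ (by omega) hf z hz
    rw [hasFDerivAt_iff_isLittleO]
    simp only [_root_.zero_apply, sub_zero, hz0]
    have : (fun w : V3 × V3 => GG N h w) =O[nhds z] fun w => ‖w - z‖ ^ 2 := by
      refine Asymptotics.IsBigO.of_bound (4 * C) (Filter.Eventually.of_forall fun w => ?_)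
      have h1 : nrm w.2 ≤ 2 * ‖w - z‖ := by
        have := nrm_le_norm w.2
        have h2 : w.2 = (w - z).2 := by simp [hz]
        rw [h2] at this ⊢
        exact this.trans (by gcongr; exact norm_snd_le _)
      have h2 := hC w
      simp only [pow_zero, one_mul] at h2
      have h3 : nrm w.2 ^ 2 ≤ (2 * ‖w - z‖) ^ 2 := by gcongr; exact nrm_nonneg _
      rw [norm_pow, norm_norm]
      nlinarith
    refine this.trans_isLittleO ?_
    exact Asymptotics.isLittleO_norm_pow_id one_lt_two |>.comp_tendsto (by
      have : Filter.Tendsto (fun w => w - z) (nhds z) (nhds (z - z)) :=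
        (continuous_id.sub continuous_const).tendsto z
      simpa using this)
  · have hp := nrm_pos hz
    have hn : HasFDerivAt (fun z : V3 × V3 => nrm z.2) (ellM (prj z)) z :=
      (nrm_hasFDerivAt hz).comp z hasFDerivAt_snd
    have hi := (hasDerivAt_inv hp.ne').comp_hasFDerivAt z hn
    have hpw := hi.pow N
    have hc := (h.hasFDerivAt (prj z)).comp z (prj_hasFDerivAt hz)
    have := hpw.smul hc
    refine this.congr_fderiv ?_
    rw [GG, hh']
    cases N with
    | zero => ext v <;> simp
    | succ N =>
      ext v <;> simp [smul_smul] <;> field_simp <;> module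

theorem GG_main (n : ℕ) : ∀ {F : Type} [NormedAddCommGroup F] [NormedSpace ℝ F] (N : ℕ) (h : 𝓢(EE, F)),
    Fl ZE (N + 2 * n + 2) h → ContDiff ℝ n (GG N h) ∧
      ∀ k, ∃ C, ∀ z, ‖z‖ ^ k * ‖iteratedFDeriv ℝ n (GG N h) z‖ ≤ C := by
  induction n with
  | zero =>
    intro F _ _ N h hf
    constructor
    · rw [Nat.cast_zero, contDiff_zero, continuous_iff_continuousAt]
      intro z
      by_cases hz : z.2 = 0
      · have hz0 := GG_zero N h _ (by omega) hf z hz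
        obtain ⟨C, hCp, hC⟩ := GG_bound' N 1 h hf 0
        rw [ContinuousAt, hz0]
        refine squeeze_zero_norm (a := fun w => C * (2 * ‖w.2‖)) (fun w => ?_) ?_
        · have h2 := hC w
          simp only [pow_zero, one_mul, pow_one] at h2
          exact h2.trans (by gcongr; exact nrm_le_norm _)
        · have : Continuous (fun w : V3 × V3 => C * (2 * ‖w.2‖)) := by fun_prop
          have := this.tendsto z
          simpa [hz] using this
      · have h1 : ContinuousAt prj z := (prj_hasFDerivAt hz).continuousAt
        have h2 : ContinuousAt (fun z : V3 × V3 => nrm z.2) z :=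
          ((nrm_hasFDerivAt hz).comp z hasFDerivAt_snd).continuousAt
        exact ((h2.inv₀ (nrm_pos hz).ne').pow N).smul (h.continuous.continuousAt.comp h1)
    · intro k
      obtain ⟨C, hCp, hC⟩ := GG_bound' N 0 h (hf.mono (by omega)) k
      exact ⟨C, fun z => by simpa using hC z⟩
  | succ n ih =>
    intro F _ _ N h hf
    obtain ⟨h', hf', hh'⟩ := exists_T N (N + 2 * n + 3) h (hf.mono (by omega))
    have hd := GG_hasFDerivAt N h (hf.mono (by omega)) h' hh'
    have he : fderiv ℝ (GG N h) = GG (N + 1) h' := funext fun z => (hd z).fderiv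
    obtain ⟨c1, c2⟩ := ih (N + 1) h' (hf'.mono (by omega))
    constructor
    · rw [Nat.cast_succ, contDiff_succ_iff_fderiv]
      refine ⟨fun z => (hd z).differentiableAt, fun h => by simp at h, by rwa [he]⟩
    · intro k
      obtain ⟨C, hC⟩ := c2 k
      refine ⟨C, fun z => ?_⟩
      rw [← norm_iteratedFDeriv_fderiv, he]
      exact hC z
end

theorem exists_chi : ∃ χ : V3 → ℝ, ContDiff ℝ ∞ χ ∧ HasCompactSupport χ ∧ ∀ u, nrm u = 1 → χ u = 1 := by
  let χ : ContDiffBump (0 : V3) := ⟨1, 2, one_pos, one_lt_two⟩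
  refine ⟨χ, χ.contDiff, χ.hasCompactSupport, fun u hu => χ.one_of_mem_closedBall ?_⟩
  simp only [Metric.mem_closedBall, dist_zero_right]
  exact (norm_le_nrm u).trans hu.le

theorem exists_theta : ∃ θ : V3 → ℝ, ContDiff ℝ ∞ θ ∧ HasCompactSupport θ ∧
    ∀ u, nrm u = 1 → -(1 / 2) ≤ u 2 → θ u * (1 + u 2) = 1 := by
  obtain ⟨χ, h1, h2, h3⟩ := exists_chi
  let B : ContDiffBump (1 / 4 : ℝ) := ⟨3 / 4, 1, by norm_num, by norm_num⟩
  have hB : ContDiff ℝ ∞ (fun c : ℝ => B c / (1 + c)) := by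
    rw [contDiff_iff_contDiffAt]
    intro c
    by_cases hc : c < -(3 / 4)
    · have : (fun c : ℝ => B c / (1 + c)) =ᶠ[nhds c] fun _ => 0 := by
        filter_upwards [Iio_mem_nhds hc] with d hd
        have : B d = 0 := B.zero_of_le_dist (by
          rw [Real.dist_eq]; simp only [Set.mem_Iio] at hd
          rw [abs_of_neg (by linarith)]; show (1 : ℝ) ≤ _; linarith)
        rw [this, zero_div]
      exact contDiffAt_const.congr_of_eventuallyEq this
    · exact B.contDiffAt.div (by fun_prop) (by linarith)
  refine ⟨fun u => χ u * (B (u 2) / (1 + u 2)), h1.mul (hB.comp (contDiff_apply ℝ ℝ 2)),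
    h2.mul_right, fun u hu hu2 => ?_⟩
  have hle : u 2 ≤ 1 := by
    have := nrm_sq u; rw [hu] at this
    nlinarith [sq_nonneg (u 0), sq_nonneg (u 1)]
  have : B (u 2) = 1 := B.one_of_mem_closedBall (by
    rw [Metric.mem_closedBall, Real.dist_eq]
    show _ ≤ (3 / 4 : ℝ)
    rw [abs_le]; constructor <;> linarith)
  simp only [h3 u hu, this]
  field_simp [show (1 + u 2) ≠ 0 by linarith]

def theta : V3 → ℝ := exists_theta.choose
theorem theta_smooth : ContDiff ℝ ∞ theta := exists_theta.choose_spec.1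
theorem theta_cs : HasCompactSupport theta := exists_theta.choose_spec.2.1
theorem theta_spec : ∀ u, nrm u = 1 → -(1 / 2) ≤ u 2 → theta u * (1 + u 2) = 1 :=
  exists_theta.choose_spec.2.2

theorem exists_alpha : ∃ α α' : V3 → ℝ, (ContDiff ℝ ∞ α ∧ HasCompactSupport α) ∧
    (ContDiff ℝ ∞ α' ∧ HasCompactSupport α') ∧ (∀ u, nrm u = 1 → α u + α' u = 1) ∧
    (∀ u, α u ≠ 0 → -(1 / 2) ≤ u 2) ∧ (∀ u, α' u ≠ 0 → u 2 ≤ 1 / 2) := by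
  obtain ⟨χ, h1, h2, h3⟩ := exists_chi
  have hs : ContDiff ℝ ∞ (fun u : V3 => Real.smoothTransition (u 2 + 1 / 2)) :=
    Real.smoothTransition.contDiff.comp ((contDiff_apply ℝ ℝ 2).add contDiff_const)
  refine ⟨fun u => χ u * Real.smoothTransition (u 2 + 1 / 2),
    fun u => χ u * (1 - Real.smoothTransition (u 2 + 1 / 2)), ⟨h1.mul hs, h2.mul_right⟩,
    ⟨h1.mul (contDiff_const.sub hs), h2.mul_right⟩, ?_, ?_, ?_⟩
  · intro u hu; simp only [h3 u hu]; ring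
  · intro u hu
    by_contra h
    exact hu (by simp only []; rw [Real.smoothTransition.zero_of_nonpos (by linarith), mul_zero])
  · intro u hu
    by_contra h
    exact hu (by simp only []; rw [Real.smoothTransition.one_of_one_le (by linarith)]; simp)

def al : V3 → ℝ := exists_alpha.choose
def al' : V3 → ℝ := exists_alpha.choose_spec.choose
theorem al_spec : (ContDiff ℝ ∞ al ∧ HasCompactSupport al) ∧
    (ContDiff ℝ ∞ al' ∧ HasCompactSupport al') ∧ (∀ u, nrm u = 1 → al u + al' u = 1) ∧
    (∀ u, al u ≠ 0 → -(1 / 2) ≤ u 2) ∧ (∀ u, al' u ≠ 0 → u 2 ≤ 1 / 2) :=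
  exists_alpha.choose_spec.choose_spec

/-- transposed rotation minus identity -/
def Rm (a b : ℝ) : Mat3 :=
  !![1 - 2 * b ^ 2 / (1 + a ^ 2 + b ^ 2), 2 * a * b / (1 + a ^ 2 + b ^ 2), 2 * b / (1 + a ^ 2 + b ^ 2);
     2 * a * b / (1 + a ^ 2 + b ^ 2), 1 - 2 * a ^ 2 / (1 + a ^ 2 + b ^ 2), -2 * a / (1 + a ^ 2 + b ^ 2);
     -2 * b / (1 + a ^ 2 + b ^ 2), 2 * a / (1 + a ^ 2 + b ^ 2),
       1 - 2 * (a ^ 2 + b ^ 2) / (1 + a ^ 2 + b ^ 2)]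

theorem Rm_mem (a b : ℝ) : Rm a b ∈ SO3 := by
  have hD : 1 + a ^ 2 + b ^ 2 ≠ 0 := by positivity
  constructor
  · ext i j
    fin_cases i <;> fin_cases j <;>
      simp [Rm, Matrix.mul_apply, Fin.sum_univ_three] <;> field_simp <;> ring
  · rw [Matrix.det_fin_three]
    simp [Rm]
    field_simp
    ring

def Rot (u : V3) : Mat3 := Rm (-u 1 * theta u) (u 0 * theta u)

theorem Rot_mem (u : V3) : Rot u ∈ SO3 := Rm_mem _ _

theorem Rot_e3 (u : V3) (hu : nrm u = 1) (h2 : -(1 / 2) ≤ u 2) (t : ℝ) :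
    (Rot u) *ᵥ ![0, 0, t] = t • u := by
  have hθ := theta_spec u hu h2
  have hp : 1 + u 2 ≠ 0 := by linarith
  have ht : theta u = 1 / (1 + u 2) := by field_simp; linarith
  have hn := nrm_sq u
  rw [hu] at hn
  have hD : 1 + (-u 1 * theta u) ^ 2 + (u 0 * theta u) ^ 2 = 2 / (1 + u 2) := by
    rw [ht]; field_simp; nlinarith
  have hE : (-u 1 * theta u) ^ 2 + (u 0 * theta u) ^ 2 = 2 / (1 + u 2) - 1 := by linarith
  ext i
  fin_cases i <;> simp [Rot, Rm, Matrix.mulVec, dotProduct, Fin.sum_univ_three] <;>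
    simp only [neg_mul, even_two, Even.neg_pow] at hD hE <;> rw [hD] <;> try rw [hE]
  · rw [ht]; field_simp
  · rw [ht]; field_simp
  · field_simp; ring

theorem SO3_mul {A B : Mat3} (hA : A ∈ SO3) (hB : B ∈ SO3) : A * B ∈ SO3 := by
  refine ⟨?_, by rw [Matrix.det_mul, hA.2, hB.2, one_mul]⟩
  rw [Matrix.transpose_mul, Matrix.mul_assoc, ← Matrix.mul_assoc B, hB.1, Matrix.one_mul, hA.1]

theorem SO3_tmul {A : Mat3} (hA : A ∈ SO3) : Aᵀ * A = 1 := mul_eq_one_comm.1 hA.1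

theorem SO3_transpose {A : Mat3} (hA : A ∈ SO3) : Aᵀ ∈ SO3 :=
  ⟨by rw [Matrix.transpose_transpose]; exact SO3_tmul hA, by rw [Matrix.det_transpose]; exact hA.2⟩

theorem nrm_eq_dot (y : V3) : nrm y = √(y ⬝ᵥ y) := by
  simp only [nrm, dotProduct, Fin.sum_univ_three]; congr 1; ring

theorem nrm_SO3 {A : Mat3} (hA : A ∈ SO3) (y : V3) : nrm (A *ᵥ y) = nrm y := by
  rw [nrm_eq_dot, nrm_eq_dot]
  congr 1
  rw [Matrix.dotProduct_mulVec, Matrix.vecMul_mulVec, SO3_tmul hA, Matrix.vecMul_one]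

theorem mulVec_eq_zero_SO3 {A : Mat3} (hA : A ∈ SO3) {y : V3} (h : A *ᵥ y = 0) : y = 0 := by
  have := congrArg (fun v => Aᵀ *ᵥ v) h
  simpa [Matrix.mulVec_mulVec, SO3_tmul hA] using this

theorem invK_SO3 {g : V3 × ℝ → ℂ} (hg : InvK' g) {A : Mat3} (hA : A ∈ SO3) (ε : ℝ) (hε : ε * ε = 1)
    (h3 : A *ᵥ ![0, 0, 1] = ![0, 0, ε]) (x : V3) (t : ℝ) : g (A *ᵥ x, ε * t) = g (x, t) := by
  have c0 : A 0 2 = 0 := by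
    have := congrFun h3 0; simpa [Matrix.mulVec, dotProduct, Fin.sum_univ_three] using this
  have c1 : A 1 2 = 0 := by
    have := congrFun h3 1; simpa [Matrix.mulVec, dotProduct, Fin.sum_univ_three] using this
  have c2 : A 2 2 = ε := by
    have := congrFun h3 2; simpa [Matrix.mulVec, dotProduct, Fin.sum_univ_three] using this
  have ho : ∀ i j, A i 0 * A j 0 + A i 1 * A j 1 + A i 2 * A j 2 = (1 : Mat3) i j := by
    intro i j
    have := congrFun (congrFun hA.1 i) j
    simpa [Matrix.mul_apply, Fin.sum_univ_three] using this
  have r22 := ho 2 2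
  have r0 : A 2 0 = 0 := by
    rw [c2] at r22; simp at r22
    nlinarith [sq_nonneg (A 2 0), sq_nonneg (A 2 1)]
  have r1 : A 2 1 = 0 := by
    rw [c2] at r22; simp at r22
    nlinarith [sq_nonneg (A 2 0), sq_nonneg (A 2 1)]
  have hd := hA.2
  rw [Matrix.det_fin_three, c0, c1, c2, r0, r1] at hd
  have hdet : A 0 0 * A 1 1 - A 0 1 * A 1 0 = ε := by linear_combination ε * hd - (A 0 0 * A 1 1 - A 0 1 * A 1 0) * hε
  let B : Matrix (Fin 2) (Fin 2) ℝ := !![A 0 0, A 0 1; A 1 0, A 1 1]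
  have hB : B ∈ O2 := by
    show B * Bᵀ = 1
    have h00 := ho 0 0
    have h01 := ho 0 1
    have h10 := ho 1 0
    have h11 := ho 1 1
    rw [c0] at h00 h01 h10
    rw [c1] at h11
    ext i j
    fin_cases i <;> fin_cases j <;> simp [B, Matrix.mul_apply, Fin.sum_univ_two] <;>
      simp at h00 h01 h10 h11 <;> linarith
  have hBd : B.det = ε := by simp [B, Matrix.det_fin_two, hdet]
  rw [← hg B hB (x, t)]
  congr 1
  simp only [KAct, hBd]
  congr 1
  ext i
  fin_cases i <;> simp [B, Matrix.mulVec, dotProduct, Fin.sum_univ_three, Fin.sum_univ_two, c0, c1, c2, r0, r1]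

def kap (ε : ℝ) (p : EE) : EE := (((Rot (ε • p.2))ᵀ *ᵥ p.1.1, ε * p.1.2), p.2)

theorem Rot_entry (i j : Fin 3) : ContDiff ℝ ∞ (fun u => (Rot u - 1) i j) ∧
    HasCompactSupport (fun u => (Rot u - 1) i j) := by
  have ha : ContDiff ℝ ∞ (fun u : V3 => -u 1 * theta u) := (contDiff_apply ℝ ℝ 1).neg.mul theta_smooth
  have hb : ContDiff ℝ ∞ (fun u : V3 => u 0 * theta u) := (contDiff_apply ℝ ℝ 0).mul theta_smooth
  have hD : ∀ u : V3, 1 + (-u 1 * theta u) ^ 2 + (u 0 * theta u) ^ 2 ≠ 0 := fun u => by positivity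
  have key : ContDiff ℝ ∞ (fun u => (Rot u) i j) := by
    fin_cases i <;> fin_cases j <;> simp only [Rot, Rm, Fin.zero_eta, Fin.mk_one, Fin.reduceFinMk,
      Matrix.of_apply, Matrix.cons_val', Matrix.cons_val_zero, Matrix.cons_val_one, Matrix.cons_val] <;>
      fun_prop (disch := exact hD)
  refine ⟨by simpa [Matrix.sub_apply] using key.sub contDiff_const, ?_⟩
  refine theta_cs.mono' ?_
  intro u hu
  by_contra h
  have hθ : theta u = 0 := by
    by_contra h'; exact h (subset_tsupport _ h')
  apply hu
  fin_cases i <;> fin_cases j <;> simp [Rot, Rm, hθ]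

theorem kap_temp (ε : ℝ) (hε : ε * ε = 1) : Function.HasTemperateGrowth (kap ε) := by
  let q : EE →L[ℝ] V3 := ContinuousLinearMap.snd ℝ (V3 × ℝ) V3
  let qx : EE →L[ℝ] V3 := (ContinuousLinearMap.fst ℝ V3 ℝ).comp (ContinuousLinearMap.fst ℝ (V3 × ℝ) V3)
  let A0 : EE →L[ℝ] EE := ((ContinuousLinearMap.fst ℝ V3 ℝ).prod (ε • ContinuousLinearMap.snd ℝ V3 ℝ)).prodMap
    (ContinuousLinearMap.id ℝ V3)
  let em (i : Fin 3) : EE := ((Pi.single i 1, 0), 0)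
  have e : kap ε = fun p => A0 p + ∑ i, ∑ j, ((Rot ((ε • q) p) - 1) i j *
      ((ContinuousLinearMap.proj (R := ℝ) (φ := fun _ : Fin 3 => ℝ) i).comp qx) p) • em j := by
    funext p
    have h : (Rot (ε • p.2))ᵀ *ᵥ p.1.1 = p.1.1 + (Rot (ε • p.2) - 1)ᵀ *ᵥ p.1.1 := by
      rw [Matrix.transpose_sub, Matrix.sub_mulVec]; simp
    simp only [kap, h]
    refine Prod.ext (Prod.ext ?_ ?_) ?_
    · funext k
      simp only [A0, em, q, qx, Prod.fst_add, Prod.fst_sum, Prod.smul_fst, Pi.add_apply, Finset.sum_apply]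
      fin_cases k <;> simp [Matrix.mulVec, dotProduct, Fin.sum_univ_three] 
    · simp [A0, em, Prod.fst_sum, Prod.snd_sum]
    · simp [A0, em, Prod.fst_sum, Prod.snd_sum]
  rw [e]
  refine A0.hasTemperateGrowth.add (Function.HasTemperateGrowth.sum fun i _ =>
    Function.HasTemperateGrowth.sum fun j _ => ?_)
  have t1 := ((Rot_entry i j).2.hasTemperateGrowth (Rot_entry i j).1).comp (ε • q).hasTemperateGrowth
  have t2 := ContinuousLinearMap.hasTemperateGrowth
    ((ContinuousLinearMap.proj (R := ℝ) (φ := fun _ : Fin 3 => ℝ) i).comp qx)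
  exact (t1.mul t2).smul (.const (em j))

theorem kap_lower (ε : ℝ) (hε : ε * ε = 1) (p : EE) : ‖p‖ ≤ 2 * (1 + ‖kap ε p‖) ^ 1 := by
  have h1 : ‖p.1.1‖ ≤ 2 * ‖kap ε p‖ := by
    have := nrm_le_norm ((Rot (ε • p.2))ᵀ *ᵥ p.1.1)
    rw [nrm_SO3 (SO3_transpose (Rot_mem _))] at this
    have h2 : ‖(Rot (ε • p.2))ᵀ *ᵥ p.1.1‖ ≤ ‖kap ε p‖ :=
      (norm_fst_le (kap ε p).1).trans (norm_fst_le (kap ε p))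
    linarith [norm_le_nrm p.1.1]
  have h2 : ‖p.1.2‖ ≤ ‖kap ε p‖ := by
    have : ‖ε * p.1.2‖ ≤ ‖kap ε p‖ := (norm_snd_le (kap ε p).1).trans (norm_fst_le (kap ε p))
    rwa [norm_mul, show ‖ε‖ = 1 by rcases mul_self_eq_one_iff.1 hε with rfl | rfl <;> simp, one_mul] at this
  have h3 : ‖p.2‖ ≤ ‖kap ε p‖ := norm_snd_le (kap ε p)
  have := norm_nonneg (kap ε p)
  rw [Prod.norm_def, Prod.norm_def]
  refine max_le (max_le ?_ ?_) ?_ <;> linarith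

theorem term_S (ε : ℝ) (hε : ε * ε = 1) (b : V3 → ℝ) (hbs : ContDiff ℝ ∞ b) (hb : HasCompactSupport b)
    (φ : 𝓢(V3 × ℝ, ℂ)) (m : ℕ) (hf : Fl {q : V3 × ℝ | q.2 = 0} m φ) :
    ∃ h : 𝓢(EE, ℂ), (∀ p, h p = b p.2 • φ (kap ε p).1) ∧ Fl ZE m h := by
  obtain ⟨ψ, hψ⟩ := tensorS φ b hb hbs
  let h := SchwartzMap.compCLM ℝ (kap_temp ε hε) ⟨1, 2, kap_lower ε hε⟩ ψ
  have e : ∀ p, h p = b p.2 • φ (kap ε p).1 := fun p => hψ _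
  refine ⟨h, e, ?_⟩
  have e' : ⇑h = fun p => (ContinuousLinearMap.lsmul ℝ ℝ : ℝ →L[ℝ] ℂ →L[ℝ] ℂ).flip (φ (kap ε p).1) (b p.2) :=
    funext e
  rw [e']
  have hk : ContDiff ℝ ∞ (fun p => (kap ε p).1) := contDiff_fst.comp (kap_temp ε hε).1
  refine Fl.bilin _ ((φ.smooth ⊤).comp hk) (hbs.comp contDiff_snd) ?_
  refine Fl.comp (φ.smooth ⊤) hk ?_ hf
  intro p hp
  simp only [ZE, Set.mem_ofPred_eq] at hp
  simp [kap, hp]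

def EX (φ : V3 × ℝ → ℂ) (p : EE) : ℂ := al p.2 • φ (kap 1 p).1 + al' p.2 • φ (kap (-1) p).1

theorem EX_S (φ : 𝓢(V3 × ℝ, ℂ)) (m : ℕ) (hf : Fl {q : V3 × ℝ | q.2 = 0} m φ) :
    ∃ h : 𝓢(EE, ℂ), ⇑h = EX φ ∧ Fl ZE m h := by
  obtain ⟨h1, e1, f1⟩ := term_S 1 (by norm_num) al al_spec.1.1 al_spec.1.2 φ m hf
  obtain ⟨h2, e2, f2⟩ := term_S (-1) (by norm_num) al' al_spec.2.1.1 al_spec.2.1.2 φ m hf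
  refine ⟨h1 + h2, ?_, Fl.add (h1.smooth ⊤) (h2.smooth ⊤) f1 f2⟩
  funext p
  simp [EX, e1, e2]

theorem nrm_smul (c : ℝ) (y : V3) : nrm (c • y) = |c| * nrm y := by
  simp only [nrm, Pi.smul_apply, smul_eq_mul]
  rw [← Real.sqrt_sq_eq_abs, ← Real.sqrt_mul (sq_nonneg c)]
  congr 1; ring

theorem nrm_unit {y : V3} (hy : y ≠ 0) : nrm ((nrm y)⁻¹ • y) = 1 := by
  have := nrm_pos hy
  rw [nrm_smul, abs_of_pos (by positivity)]; field_simp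

/-- if `φ` agrees with `c` at all rotated points then `EX φ` gives `c` -/
theorem EX_eq (φ : V3 × ℝ → ℂ) (x y : V3) (hy : y ≠ 0) (c : ℂ)
    (h : ∀ k ∈ SO3, ∀ t : ℝ, k *ᵥ ![0, 0, t] = y → φ (kᵀ *ᵥ x, t) = c) : EX φ (prj (x, y)) = c := by
  have hn := nrm_pos hy
  have hu := nrm_unit hy
  obtain ⟨-, -, h3, h4, h5⟩ := al_spec
  set u := (nrm y)⁻¹ • y with hud
  have huy : nrm y • u = y := by rw [hud, smul_smul, mul_inv_cancel₀ hn.ne', one_smul]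
  have t1 : al u • φ (kap 1 (prj (x, y))).1 = al u • c := by
    by_cases h0 : al u = 0
    · simp [h0]
    congr 1
    have : (kap 1 (prj (x, y))).1 = ((Rot u)ᵀ *ᵥ x, nrm y) := by simp [kap, prj, hud]
    rw [this]
    exact h _ (Rot_mem _) _ (by rw [Rot_e3 u hu (h4 u h0), huy])
  have t2 : al' u • φ (kap (-1) (prj (x, y))).1 = al' u • c := by
    by_cases h0 : al' u = 0
    · simp [h0]
    congr 1
    have : (kap (-1) (prj (x, y))).1 = ((Rot (-u))ᵀ *ᵥ x, -nrm y) := by simp [kap, prj, hud]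
    rw [this]
    refine h _ (Rot_mem _) _ ?_
    rw [Rot_e3 (-u) (by rw [← neg_one_smul ℝ u, nrm_smul, hu]; simp)
      (by have := h5 u h0; simp; linarith)]
    rw [smul_neg, neg_smul, neg_neg, huy]
  have : EX φ (prj (x, y)) = al u • φ (kap 1 (prj (x, y))).1 + al' u • φ (kap (-1) (prj (x, y))).1 := rfl
  rw [this, t1, t2, ← add_smul, h3 u hu, one_smul]

theorem EX_of_inv (Φ : V3 × V3 → ℂ) (hΦ : Inv3 Φ) (φ : V3 × ℝ → ℂ) (hφ : ∀ x t, φ (x, t) = Φ (x, ![0, 0, t]))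
    (x y : V3) (hy : y ≠ 0) : EX φ (prj (x, y)) = Φ (x, y) := by
  refine EX_eq φ x y hy _ fun k hk t hkt => ?_
  rw [hφ, ← hΦ k hk, Matrix.mulVec_mulVec, hk.1, Matrix.one_mulVec, hkt]

theorem exists_rot {y : V3} (hy : y ≠ 0) : ∃ k ∈ SO3, ∃ t : ℝ, k *ᵥ ![0, 0, t] = y := by
  have hn := nrm_pos hy
  have hu := nrm_unit hy
  set u := (nrm y)⁻¹ • y with hud
  have huy : nrm y • u = y := by rw [hud, smul_smul, mul_inv_cancel₀ hn.ne', one_smul]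
  rcases le_total 0 (u 2) with h | h
  · exact ⟨Rot u, Rot_mem _, nrm y, by rw [Rot_e3 u hu (by linarith), huy]⟩
  · refine ⟨Rot (-u), Rot_mem _, -nrm y, ?_⟩
    rw [Rot_e3 (-u) (by rw [← neg_one_smul ℝ u, nrm_smul, hu]; simp) (by simp; linarith)]
    rw [smul_neg, neg_smul, neg_neg, huy]

theorem invK_indep {g : V3 × ℝ → ℂ} (hg : InvK' g) {y : V3} (hy : y ≠ 0) {k l : Mat3} (hk : k ∈ SO3)
    (hl : l ∈ SO3) {t s : ℝ} (hkt : k *ᵥ ![0, 0, t] = y) (hls : l *ᵥ ![0, 0, s] = y) (x : V3) :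
    g (kᵀ *ᵥ x, t) = g (lᵀ *ᵥ x, s) := by
  have hs : s ≠ 0 := by
    rintro rfl
    apply hy
    rw [← hls]
    have : (![0, 0, 0] : V3) = 0 := by ext i; fin_cases i <;> rfl
    rw [this, Matrix.mulVec_zero]
  have e : ∀ c : ℝ, (![0, 0, c] : V3) = c • ![0, 0, 1] := by
    intro c; ext i; fin_cases i <;> simp
  have hnt : t ^ 2 = s ^ 2 := by
    have := congrArg nrm (hkt.trans hls.symm)
    rw [nrm_SO3 hk, nrm_SO3 hl] at this
    have h2 : nrm ![0, 0, t] ^ 2 = nrm ![0, 0, s] ^ 2 := by rw [this]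
    simpa [nrm_sq] using h2
  have hA := SO3_mul (SO3_transpose hk) hl
  have h3 : (kᵀ * l) *ᵥ ![0, 0, s] = ![0, 0, t] := by
    rw [← Matrix.mulVec_mulVec, hls, ← hkt, Matrix.mulVec_mulVec, SO3_tmul hk, Matrix.one_mulVec]
  have h4 : (kᵀ * l) *ᵥ ![0, 0, 1] = ![0, 0, t / s] := by
    rw [e s, Matrix.mulVec_smul] at h3
    have h5 := congrArg (fun v => s⁻¹ • v) h3
    simp only [smul_smul, inv_mul_cancel₀ hs, one_smul] at h5
    rw [h5]; ext i; fin_cases i <;> simp; ring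
  have := invK_SO3 hg hA (t / s) (by field_simp; linarith) h4 (lᵀ *ᵥ x) s
  rw [← this, Matrix.mulVec_mulVec, Matrix.mul_assoc, hl.1, Matrix.mul_one, div_mul_cancel₀ _ hs]

/-- The canonical extension. -/
def ext3 (g : V3 × ℝ → ℂ) (z : V3 × V3) : ℂ := open Classical in if z.2 = 0 then g (z.1, 0) else EX g (prj z)

theorem ext3_eq {g : V3 × ℝ → ℂ} (hg : InvK' g) (h0 : ∀ k ∈ SO3, ∀ x, g (k *ᵥ x, 0) = g (x, 0))
    (x y : V3) {k : Mat3} (hk : k ∈ SO3) {t : ℝ} (hkt : k *ᵥ ![0, 0, t] = y) :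
    ext3 g (x, y) = g (kᵀ *ᵥ x, t) := by
  by_cases hy : y = 0
  · have ht : t = 0 := by
      rw [hy] at hkt
      exact congrFun (mulVec_eq_zero_SO3 hk hkt) 2
    simp only [ext3, hy, if_true]
    rw [ht, h0 _ (SO3_transpose hk)]
  · simp only [ext3, hy, if_false]
    exact EX_eq g x y hy _ fun l hl s hls => invK_indep hg hy hl hk hls hkt x

theorem one_mem_SO3 : (1 : Mat3) ∈ SO3 := ⟨by simp, by simp⟩

theorem exists_rot' (y : V3) : ∃ k ∈ SO3, ∃ t : ℝ, k *ᵥ ![0, 0, t] = y := by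
  by_cases hy : y = 0
  · refine ⟨1, one_mem_SO3, 0, ?_⟩
    rw [hy, Matrix.one_mulVec]
    ext i; fin_cases i <;> rfl
  · exact exists_rot hy

theorem ext3_restrict {g : V3 × ℝ → ℂ} (hg : InvK' g) (h0 : ∀ k ∈ SO3, ∀ x, g (k *ᵥ x, 0) = g (x, 0))
    (x : V3) (t : ℝ) : ext3 g (x, ![0, 0, t]) = g (x, t) := by
  rw [ext3_eq hg h0 x _ one_mem_SO3 (Matrix.one_mulVec _)]; simp

theorem ext3_inv {g : V3 × ℝ → ℂ} (hg : InvK' g) (h0 : ∀ k ∈ SO3, ∀ x, g (k *ᵥ x, 0) = g (x, 0)) :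
    Inv3 (ext3 g) := by
  intro k hk x y
  obtain ⟨l, hl, t, hlt⟩ := exists_rot' y
  rw [ext3_eq hg h0 x y hl hlt, ext3_eq hg h0 (k *ᵥ x) (k *ᵥ y) (SO3_mul hk hl) (t := t)
    (by rw [← Matrix.mulVec_mulVec, hlt])]
  rw [Matrix.transpose_mul, Matrix.mulVec_mulVec, Matrix.mul_assoc, SO3_tmul hk, Matrix.mul_one]


def Ds {F : Type} [NormedAddCommGroup F] [NormedSpace ℝ F] (φ : V3 × ℝ → F) (p : V3 × ℝ) : F :=
  fderiv ℝ φ p (0, 1)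

theorem Ds_smooth {F : Type} [NormedAddCommGroup F] [NormedSpace ℝ F] {φ : V3 × ℝ → F}
    (h : ContDiff ℝ ∞ φ) : ContDiff ℝ ∞ (Ds φ) :=
  (h.fderiv_right (m := ∞) (by norm_num)).clm_apply contDiff_const

theorem Ds_iter_smooth {F : Type} [NormedAddCommGroup F] [NormedSpace ℝ F] {φ : V3 × ℝ → F}
    (h : ContDiff ℝ ∞ φ) (i : ℕ) : ContDiff ℝ ∞ (Ds^[i] φ) := by
  induction i with
  | zero => exact h
  | succ i ih => rw [Function.iterate_succ_apply']; exact Ds_smooth ih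

theorem Ds_fderiv {F : Type} [NormedAddCommGroup F] [NormedSpace ℝ F] {φ : V3 × ℝ → F}
    (h : ContDiff ℝ ∞ φ) : Ds (fderiv ℝ φ) = fderiv ℝ (Ds φ) := by
  funext p
  refine ContinuousLinearMap.ext fun v => ?_
  have hd : DifferentiableAt ℝ (fderiv ℝ φ) p :=
    ((h.fderiv_right (m := ∞) (by norm_num)).differentiable (by norm_num)) p
  have : fderiv ℝ (Ds φ) p v = fderiv ℝ (fderiv ℝ φ) p v (0, 1) := by
    have := (hd.hasFDerivAt.clm_apply (hasFDerivAt_const ((0, 1) : V3 × ℝ) p)).fderiv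
    unfold Ds
    rw [this]; simp
  rw [this]
  exact (h.contDiffAt.isSymmSndFDerivAt (by simp; exact WithTop.coe_le_coe.2 le_top)) _ _

theorem Ds_iter_fderiv {F : Type} [NormedAddCommGroup F] [NormedSpace ℝ F] {φ : V3 × ℝ → F}
    (h : ContDiff ℝ ∞ φ) (i : ℕ) : Ds^[i] (fderiv ℝ φ) = fderiv ℝ (Ds^[i] φ) := by
  induction i with
  | zero => rfl
  | succ i ih => rw [Function.iterate_succ_apply', Function.iterate_succ_apply', ih,
      Ds_fderiv (Ds_iter_smooth h i)]

theorem Fl_of_Ds (m : ℕ) : ∀ {F : Type} [NormedAddCommGroup F] [NormedSpace ℝ F] {φ : V3 × ℝ → F},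
    ContDiff ℝ ∞ φ → (∀ i < m, ∀ x, (Ds^[i] φ) (x, 0) = 0) → Fl {q : V3 × ℝ | q.2 = 0} m φ := by
  induction m with
  | zero => intro F _ _ φ _ _ j hj; omega
  | succ m ih =>
    intro F _ _ φ h h0
    refine Fl.of_fderiv ?_ (ih (h.fderiv_right (by norm_num)) ?_)
    · rintro ⟨x, t⟩ (rfl : t = 0)
      exact h0 0 (by omega) x
    · intro i hi x
      rw [Ds_iter_fderiv h]
      have hd : DifferentiableAt ℝ (Ds^[i] φ) (x, 0) := (Ds_iter_smooth h i).differentiable (by norm_num) _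
      refine ContinuousLinearMap.ext fun v => ?_
      have e : v = ContinuousLinearMap.inl ℝ V3 ℝ v.1 + v.2 • ((0, 1) : V3 × ℝ) := by
        ext <;> simp
      have h1 : fderiv ℝ (Ds^[i] φ) (x, 0) (0, 1) = 0 := by
        have := h0 (i + 1) (by omega) x
        rwa [Function.iterate_succ_apply'] at this
      have h2 : fderiv ℝ (Ds^[i] φ) (x, 0) (ContinuousLinearMap.inl ℝ V3 ℝ v.1) = 0 := by
        have c : HasFDerivAt (fun u : V3 => (Ds^[i] φ) (ContinuousLinearMap.inl ℝ V3 ℝ u))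
          ((fderiv ℝ (Ds^[i] φ) (x, 0)).comp (ContinuousLinearMap.inl ℝ V3 ℝ)) x :=
          HasFDerivAt.comp x (f := ContinuousLinearMap.inl ℝ V3 ℝ) (g := Ds^[i] φ) hd.hasFDerivAt
            (ContinuousLinearMap.inl ℝ V3 ℝ).hasFDerivAt
        have e0 : (fun u : V3 => (Ds^[i] φ) (ContinuousLinearMap.inl ℝ V3 ℝ u)) = fun _ => 0 :=
          funext fun u => h0 i (by omega) u
        rw [e0] at c
        have := c.unique (hasFDerivAt_const 0 x)
        exact congrArg (fun L => L v.1) this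
      rw [e, map_add, map_smul, h1, h2]; simp

theorem deriv_slice {φ : V3 × ℝ → ℂ} (h : ContDiff ℝ ∞ φ) (i : ℕ) (x : V3) :
    deriv^[i] (fun s => φ (x, s)) = fun s => (Ds^[i] φ) (x, s) := by
  induction i with
  | zero => rfl
  | succ i ih =>
    rw [Function.iterate_succ_apply', ih, Function.iterate_succ_apply']
    funext s
    have hd : DifferentiableAt ℝ (Ds^[i] φ) (x, s) := (Ds_iter_smooth h i).differentiable (by norm_num) _
    exact (HasFDerivAt.comp_hasDerivAt s (f := fun s => (x, s)) hd.hasFDerivAt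
      ((hasDerivAt_const s x).prodMk (hasDerivAt_id s))).deriv

/-- being (the underlying function of) a Schwartz function -/
def IsS {E F : Type} [NormedAddCommGroup E] [NormedSpace ℝ E] [NormedAddCommGroup F] [NormedSpace ℝ F]
    (f : E → F) : Prop := ∃ ψ : 𝓢(E, F), ⇑ψ = f

section
variable {E F : Type} [NormedAddCommGroup E] [NormedSpace ℝ E] [NormedAddCommGroup F] [NormedSpace ℝ F]

theorem IsS.smooth {f : E → F} (h : IsS f) : ContDiff ℝ ∞ f := by
  obtain ⟨ψ, rfl⟩ := h; exact ψ.smooth ⊤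

theorem IsS.zero : IsS (fun _ : E => (0 : F)) := ⟨0, rfl⟩

theorem IsS.add {f g : E → F} (hf : IsS f) (hg : IsS g) : IsS (fun x => f x + g x) := by
  obtain ⟨a, rfl⟩ := hf; obtain ⟨b, rfl⟩ := hg; exact ⟨a + b, rfl⟩

theorem IsS.sub {f g : E → F} (hf : IsS f) (hg : IsS g) : IsS (fun x => f x - g x) := by
  obtain ⟨a, rfl⟩ := hf; obtain ⟨b, rfl⟩ := hg; exact ⟨a - b, rfl⟩

theorem IsS.smul {f : E → F} (c : ℝ) (hf : IsS f) : IsS (fun x => c • f x) := by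
  obtain ⟨a, rfl⟩ := hf; exact ⟨c • a, rfl⟩

theorem IsS.cmul {f : E → ℂ} (c : ℂ) (hf : IsS f) : IsS (fun x => c * f x) := by
  obtain ⟨a, rfl⟩ := hf; exact ⟨c • a, rfl⟩

theorem IsS.sum {ι : Type} (s : Finset ι) {f : ι → E → F} (hf : ∀ i ∈ s, IsS (f i)) :
    IsS (fun x => ∑ i ∈ s, f i x) := by
  classical
  induction s using Finset.induction_on with
  | empty => simpa using IsS.zero
  | insert a s ha ih =>
    simp only [Finset.sum_insert ha]
    exact (hf a (by simp)).add (ih fun i hi => hf i (by simp [hi]))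

theorem IsS.tensor {D : Type} [NormedAddCommGroup D] [NormedSpace ℝ D] {f : E → F} (hf : IsS f) {b : D → ℝ} (hb : HasCompactSupport b) (hbs : ContDiff ℝ ∞ b) :
    IsS (fun p : E × D => b p.2 • f p.1) := by
  obtain ⟨a, rfl⟩ := hf
  obtain ⟨ψ, h⟩ := tensorS a b hb hbs
  exact ⟨ψ, funext h⟩
end

theorem IsS.Ds_iter {φ : V3 × ℝ → ℂ} (h : IsS φ) (i : ℕ) : IsS (Ds^[i] φ) := by
  induction i with
  | zero => exact h
  | succ i ih =>
    rw [Function.iterate_succ_apply']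
    obtain ⟨a, ha⟩ := ih
    rw [← ha]
    exact ⟨SchwartzMap.evalCLM ℝ (V3 × ℝ) ℂ (0, 1) (SchwartzMap.fderivCLM ℝ (V3 × ℝ) ℂ a), rfl⟩

theorem IsS.slice0 {φ : V3 × ℝ → ℂ} (h : IsS φ) : IsS (fun x => φ (x, 0)) := by
  obtain ⟨a, rfl⟩ := h
  refine ⟨SchwartzMap.compCLM ℝ (g := ContinuousLinearMap.inl ℝ V3 ℝ)
    (ContinuousLinearMap.hasTemperateGrowth _) ⟨1, 1, fun x => ?_⟩ a, rfl⟩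
  have : ‖ContinuousLinearMap.inl ℝ V3 ℝ x‖ = ‖x‖ := by simp [Prod.norm_def]
  rw [this]; linarith

theorem IsS.rot {φ : V3 → ℂ} (h : IsS φ) {k : Mat3} (hk : k ∈ SO3) : IsS (fun x => φ (k *ᵥ x)) := by
  obtain ⟨a, rfl⟩ := h
  let K : V3 →L[ℝ] V3 := LinearMap.toContinuousLinearMap (Matrix.mulVecLin k)
  refine ⟨SchwartzMap.compCLM ℝ (g := K) (ContinuousLinearMap.hasTemperateGrowth _) ⟨1, 2, fun x => ?_⟩ a, rfl⟩
  have h1 := nrm_le_norm (k *ᵥ x)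
  rw [nrm_SO3 hk] at h1
  have h2 : K x = k *ᵥ x := rfl
  rw [h2]
  linarith [norm_le_nrm x]

def vmon (I : Finset (ℕ × ℕ × ℕ)) (y : V3) (m : I) : ℝ := y 0 ^ m.1.1 * y 1 ^ m.1.2.1 * y 2 ^ m.1.2.2

theorem vmon_span (I : Finset (ℕ × ℕ × ℕ)) : Submodule.span ℝ (Set.range (vmon I)) = ⊤ := by
  by_contra hne
  obtain ⟨f, hf, hle⟩ := Submodule.exists_le_ker_of_lt_top _ (lt_top_iff_ne_top.2 hne)
  apply hf
  let ex : ℕ × ℕ × ℕ → (Fin 3 →₀ ℕ) := fun m => Finsupp.equivFunOnFinite.symm ![m.1, m.2.1, m.2.2]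
  have hex : Function.Injective ex := by
    intro a b hab
    have h := Finsupp.equivFunOnFinite.symm.injective hab
    have h0 := congrFun h 0
    have h1 := congrFun h 1
    have h2 := congrFun h 2
    simp at h0 h1 h2
    exact Prod.ext h0 (Prod.ext h1 h2)
  let p : MvPolynomial (Fin 3) ℝ := ∑ m : I, MvPolynomial.monomial (ex m.1) (f (Pi.single m 1))
  have hp : p = 0 := by
    refine MvPolynomial.funext fun y => ?_
    have h1 : f (vmon I y) = 0 := hle (Submodule.subset_span ⟨y, rfl⟩)
    rw [LinearMap.pi_apply_eq_sum_univ f] at h1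
    simp only [p, map_sum, map_zero, MvPolynomial.eval_monomial]
    rw [← h1]
    refine Finset.sum_congr rfl fun m _ => ?_
    rw [Finsupp.prod_fintype _ _ (by simp)]
    have e : (fun j : I => if m = j then (1 : ℝ) else 0) = Pi.single m 1 := by
      funext j; simp [Pi.single_apply, eq_comm]
    rw [e]
    simp [ex, Fin.prod_univ_three, vmon]
    ring
  refine LinearMap.pi_ext' fun m => LinearMap.ext_ring ?_
  have h1 := congrArg (MvPolynomial.coeff (ex m.1)) hp
  simp only [p, MvPolynomial.coeff_sum, MvPolynomial.coeff_monomial, MvPolynomial.coeff_zero] at h1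
  rw [Finset.sum_eq_single m] at h1
  · simpa using h1
  · intro b _ hb
    rw [if_neg]
    intro h
    exact hb (Subtype.ext (hex h))
  · simp

theorem coef_S (I : Finset (ℕ × ℕ × ℕ)) (c : ℕ × ℕ × ℕ → V3 → ℂ)
    (h : ∀ y : V3, IsS (fun x => ∑ m ∈ I, c m x * (y 0 : ℂ) ^ m.1 * (y 1 : ℂ) ^ m.2.1 * (y 2 : ℂ) ^ m.2.2))
    (m : ℕ × ℕ × ℕ) (hm : m ∈ I) : IsS (c m) := by
  have key : ∀ w : I → ℝ, IsS (fun x => ∑ m : I, w m • c m.1 x) := by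
    intro w
    have hw : w ∈ Submodule.span ℝ (Set.range (vmon I)) := by rw [vmon_span]; trivial
    induction hw using Submodule.span_induction with
    | mem w hw =>
      obtain ⟨y, rfl⟩ := hw
      convert h y using 2 with x
      rw [← Finset.sum_coe_sort I]
      refine Finset.sum_congr rfl fun m _ => ?_
      simp only [vmon, Complex.real_smul]
      push_cast
      ring
    | zero => simpa using IsS.zero
    | add a b _ _ ha hb =>
      simp only [Pi.add_apply, add_smul, Finset.sum_add_distrib]
      exact ha.add hb
    | smul r a _ ha =>
      simp only [Pi.smul_apply, smul_assoc, ← Finset.smul_sum]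
      exact ha.smul r
  have := key (Pi.single ⟨m, hm⟩ 1)
  convert this using 2 with x
  rw [Finset.sum_eq_single ⟨m, hm⟩]
  · simp
  · intro b _ hb; simp [hb]
  · simp


def bet : ContDiffBump (0 : ℝ) := ⟨1, 2, one_pos, one_lt_two⟩

theorem bet_far {s : ℝ} (h : 2 < |s|) : bet s = 0 := by
  apply bet.zero_of_le_dist
  simp only [bet, dist_zero_right, Real.norm_eq_abs]; exact h.le

theorem bet_one {s : ℝ} (h : |s| ≤ 1) : bet s = 1 :=
  bet.one_of_mem_closedBall (by simpa [bet] using h)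

def nsq (y : V3) : ℝ := y 0 ^ 2 + y 1 ^ 2 + y 2 ^ 2

theorem nsq_eq (y : V3) : nsq y = nrm y ^ 2 := by rw [nrm_sq]; rfl

theorem nsq_smooth : ContDiff ℝ ∞ nsq := by
  unfold nsq; fun_prop

theorem nsq_rot {k : Mat3} (hk : k ∈ SO3) (y : V3) : nsq (k *ᵥ y) = nsq y := by
  rw [nsq_eq, nsq_eq, nrm_SO3 hk]

theorem le_nsq (y : V3) : ‖y‖ ^ 2 ≤ nsq y := by
  rw [nsq_eq]; exact pow_le_pow_left₀ (norm_nonneg _) (norm_le_nrm y) 2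

theorem bnsq_cs (q : V3 → ℝ) : HasCompactSupport (fun y => bet (nsq y) * q y) := by
  refine HasCompactSupport.intro (isCompact_closedBall (0 : V3) 2) fun y hy => ?_
  simp only [Metric.mem_closedBall, dist_zero_right, not_le] at hy
  rw [bet_far, zero_mul]
  have := le_nsq y
  rw [abs_of_nonneg (by nlinarith)]
  nlinarith

theorem bsq_cs (q : ℝ → ℝ) : HasCompactSupport (fun t => bet (t ^ 2) * q t) := by
  refine HasCompactSupport.intro (isCompact_closedBall (0 : ℝ) 2) fun y hy => ?_
  simp only [Metric.mem_closedBall, dist_zero_right, not_le, Real.norm_eq_abs] at hy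
  rw [bet_far, zero_mul]
  rw [abs_of_nonneg (by positivity), ← sq_abs]
  nlinarith

theorem deriv_poly (N : ℕ) (c : ℕ → ℂ) (i : ℕ) :
    deriv^[i] (fun s : ℝ => ∑ M ∈ Finset.range N, c M * (s : ℂ) ^ M) =
      fun s : ℝ => ∑ M ∈ Finset.range N, c M * ((M.descFactorial i : ℕ) : ℂ) * (s : ℂ) ^ (M - i) := by
  induction i with
  | zero => simp
  | succ i ih =>
    rw [Function.iterate_succ_apply', ih]
    funext s
    refine HasDerivAt.deriv ?_
    refine HasDerivAt.fun_sum fun M _ => ?_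
    have h := ((hasDerivAt_pow (M - i) (s : ℂ)).comp_ofReal).const_mul (c M * ((M.descFactorial i : ℕ) : ℂ))
    refine h.congr_deriv ?_
    rw [Nat.descFactorial_succ, Nat.sub_sub]
    push_cast
    ring

theorem deriv_poly_zero (N : ℕ) (c : ℕ → ℂ) (i : ℕ) (hi : i < N) :
    deriv^[i] (fun s : ℝ => ∑ M ∈ Finset.range N, c M * (s : ℂ) ^ M) 0 = i.factorial * c i := by
  rw [deriv_poly]
  simp only
  rw [Finset.sum_eq_single i]
  · simp [Nat.descFactorial_self, mul_comm]
  · intro b _ hb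
    rcases lt_or_gt_of_ne hb with h | h
    · simp [Nat.descFactorial_of_lt h]
    · have : b - i ≠ 0 := by omega
      simp [this]
  · intro h; simp at h; omega

def acoef (g : V3 × ℝ → ℂ) (M : ℕ) (x : V3) : ℂ := (M.factorial : ℂ)⁻¹ * deriv^[M] (fun s => g (x, s)) 0

theorem acoef_S {g : V3 × ℝ → ℂ} (hg : IsS g) (M : ℕ) : IsS (acoef g M) := by
  have := ((hg.Ds_iter M).slice0).cmul ((M.factorial : ℂ)⁻¹)
  unfold acoef
  simp only [deriv_slice hg.smooth]
  exact this

theorem EX_sub (φ ψ : V3 × ℝ → ℂ) (p : EE) : EX (fun q => φ q - ψ q) p = EX φ p - EX ψ p := by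
  simp only [EX, smul_sub]; ring

theorem vec0 : (![0, 0, 0] : V3) = 0 := by ext i; fin_cases i <;> rfl

theorem R_h0 {g : V3 × ℝ → ℂ} (hR : PropertyR g) : ∀ k ∈ SO3, ∀ x, g (k *ᵥ x, 0) = g (x, 0) := by
  obtain ⟨P, hP, -, hr⟩ := hR 0
  have e : ∀ x, g (x, 0) = P (x, 0) := by
    intro x
    have := hr x 0
    rw [vec0] at this
    simp [this]
  intro k hk x
  rw [e, e, ← hP k hk x 0, Matrix.mulVec_zero]

/-- Decomposition to order `N`. -/
theorem decomp {g : V3 × ℝ → ℂ} (hg : IsS g) (hR : PropertyR g) (N : ℕ) (hN : 0 < N) :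
    ∃ (Q : V3 × V3 → ℂ) (h : 𝓢(EE, ℂ)), IsS Q ∧ Fl ZE N h ∧ ext3 g = fun z => Q z + GG 0 h z := by
  choose P hinv hpol hres using hR
  choose c hc hcP using hpol
  have hres' : ∀ M x t, P M (x, ![0, 0, t]) = acoef g M x * (t : ℂ) ^ M := hres
  have hPS : ∀ M y, IsS (fun x => P M (x, y)) := by
    intro M y
    obtain ⟨k, hk, t, hkt⟩ := exists_rot' y
    have := ((acoef_S hg M).rot (SO3_transpose hk)).cmul ((t : ℂ) ^ M)
    convert this using 2 with x
    rw [mul_comm, ← hres', ← hinv M k hk (kᵀ *ᵥ x), Matrix.mulVec_mulVec, hk.1, Matrix.one_mulVec, hkt]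
  have hcS : ∀ M, ∀ m ∈ (Finset.range (M + 1) ×ˢ Finset.range (M + 1) ×ˢ Finset.range (M + 1)).filter
            (fun m => m.1 + m.2.1 + m.2.2 = M), IsS (c M m) := by
    intro M
    refine coef_S _ _ fun y => ?_
    simp only [← hcP]
    exact hPS M y
  let Q : V3 × V3 → ℂ := fun z => bet (nsq z.2) • ∑ M ∈ Finset.range N, P M z
  have hQS : IsS Q := by
    simp only [Q, Finset.smul_sum]
    refine IsS.sum _ fun M _ => ?_
    have e : (fun z : V3 × V3 => bet (nsq z.2) • P M z) = fun z => ∑ m ∈ (Finset.range (M + 1) ×ˢ Finset.range (M + 1) ×ˢ Finset.range (M + 1)).filter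
            (fun m => m.1 + m.2.1 + m.2.2 = M), (bet (nsq z.2) * (z.2 0 ^ m.1 * z.2 1 ^ m.2.1 * z.2 2 ^ m.2.2)) • c M m z.1 := by
      funext ⟨x, y⟩
      rw [hcP, Finset.smul_sum]
      refine Finset.sum_congr rfl fun m _ => ?_
      simp only [Complex.real_smul]
      push_cast
      ring
    rw [e]
    refine IsS.sum _ fun m hm => ?_
    refine (hcS M m hm).tensor (b := fun y => bet (nsq y) * (y 0 ^ m.1 * y 1 ^ m.2.1 * y 2 ^ m.2.2)) (bnsq_cs _) ?_
    refine (bet.contDiff.comp nsq_smooth).mul ?_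
    fun_prop
  have hQinv : Inv3 Q := by
    intro k hk x y
    simp only [Q, nsq_rot hk, hinv _ k hk]
  let q : V3 × ℝ → ℂ := fun p => bet (p.2 ^ 2) • ∑ M ∈ Finset.range N, acoef g M p.1 * (p.2 : ℂ) ^ M
  have hqS : IsS q := by
    simp only [q, Finset.smul_sum]
    refine IsS.sum _ fun M _ => ?_
    have := (acoef_S hg M).tensor (b := fun t => bet (t ^ 2) * t ^ M) (bsq_cs _)
      ((bet.contDiff.comp (by fun_prop)).mul (by fun_prop))
    convert this using 2 with p
    simp only [Complex.real_smul]
    push_cast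
    ring
  have hqQ : ∀ x t, q (x, t) = Q (x, ![0, 0, t]) := by
    intro x t
    simp only [q, Q, hres']
    simp [nsq]
  have hρS := hg.sub hqS
  have hρf : Fl {p : V3 × ℝ | p.2 = 0} N (fun p => g p - q p) := by
    refine Fl_of_Ds N hρS.smooth fun i hi x => ?_
    have h1 := congrFun (deriv_slice hρS.smooth i x) 0
    rw [← h1, ← iteratedDeriv_eq_iterate]
    have hg' : ContDiff ℝ ∞ (fun s => g (x, s)) := hg.smooth.comp (contDiff_const.prodMk contDiff_id)
    have hq' : ContDiff ℝ ∞ (fun s => q (x, s)) := hqS.smooth.comp (contDiff_const.prodMk contDiff_id)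
    rw [iteratedDeriv_fun_sub (hg'.of_le (by exact_mod_cast le_top)).contDiffAt (hq'.of_le (by exact_mod_cast le_top)).contDiffAt]
    have h2 : (fun s => q (x, s)) =ᶠ[nhds 0] fun s : ℝ => ∑ M ∈ Finset.range N, acoef g M x * (s : ℂ) ^ M := by
      filter_upwards [Metric.ball_mem_nhds (0 : ℝ) one_pos] with s hs
      simp only [Metric.mem_ball, dist_zero_right, Real.norm_eq_abs] at hs
      simp only [q]
      rw [bet_one, one_smul]
      rw [abs_of_nonneg (by positivity), ← sq_abs]
      nlinarith [abs_nonneg s]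
    rw [h2.iteratedDeriv_eq, iteratedDeriv_eq_iterate, iteratedDeriv_eq_iterate, deriv_poly_zero N _ i hi, acoef]
    have : (i.factorial : ℂ) ≠ 0 := by exact_mod_cast i.factorial_ne_zero
    field_simp
    ring
  obtain ⟨ρ, hρ⟩ := hρS
  rw [← hρ] at hρf
  obtain ⟨h, hh, hf⟩ := EX_S ρ N hρf
  refine ⟨Q, h, hQS, hf, ?_⟩
  funext ⟨x, y⟩
  by_cases hy : y = 0
  · rw [GG_zero 0 h N hN hf (x, y) hy]
    simp only [ext3, hy, if_true, add_zero]
    have := hqQ x 0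
    rw [vec0] at this
    rw [← this]
    have h1 : g (x, 0) - q (x, 0) = 0 := by
      have := hρf.eq_zero hN (x, 0) rfl
      rwa [hρ] at this
    exact sub_eq_zero.1 h1
  · have h2 := EX_of_inv Q hQinv q hqQ x y hy
    simp only [ext3, hy, if_false, GG, pow_zero, one_smul, hh, hρ, EX_sub]
    rw [h2]; ring

theorem ext3_S {g : V3 × ℝ → ℂ} (hg : IsS g) (hR : PropertyR g) : IsS (ext3 g) := by
  have key : ∀ n : ℕ, ContDiff ℝ n (ext3 g) ∧ ∀ k, ∃ C, ∀ z, ‖z‖ ^ k * ‖iteratedFDeriv ℝ n (ext3 g) z‖ ≤ C := by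
    intro n
    obtain ⟨Q, h, ⟨S, rfl⟩, hf, e⟩ := decomp hg hR (0 + 2 * n + 2) (by omega)
    obtain ⟨h1, h2⟩ := GG_main n 0 h hf
    have hS : ContDiff ℝ n S := S.smooth n
    refine ⟨by rw [e]; exact hS.add h1, fun k => ?_⟩
    obtain ⟨C, hC⟩ := h2 k
    obtain ⟨C', hC'⟩ := S.decay' k n
    refine ⟨C' + C, fun z => ?_⟩
    have ea : ext3 g = ⇑S + GG 0 h := e
    rw [ea, iteratedFDeriv_add_apply hS.contDiffAt h1.contDiffAt]
    have a1 : ‖z‖ ^ k * ‖iteratedFDeriv ℝ n (⇑S) z‖ ≤ C' := hC' z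
    calc _ ≤ ‖z‖ ^ k * (‖iteratedFDeriv ℝ n (⇑S) z‖ + ‖iteratedFDeriv ℝ n (GG 0 h) z‖) := by
          gcongr; exact norm_add_le _ _
      _ ≤ _ := by rw [mul_add]; exact add_le_add a1 (hC z)
  exact ⟨⟨ext3 g, contDiff_infty.2 fun n => (key n).1, fun k n => (key n).2 k⟩, rfl⟩


theorem O2_facts {A : Matrix (Fin 2) (Fin 2) ℝ} (hA : A ∈ O2) (p : V3 × ℝ) :
    nsq (KAct A p).1 = nsq p.1 ∧ (KAct A p).2 ^ 2 = p.2 ^ 2 := by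
  have h : Aᵀ * A = 1 := mul_eq_one_comm.1 hA
  have h00 := congrFun (congrFun h 0) 0
  have h01 := congrFun (congrFun h 0) 1
  have h11 := congrFun (congrFun h 1) 1
  simp [Matrix.mul_apply, Fin.sum_univ_two] at h00 h01 h11
  have hd : A.det ^ 2 = 1 := by
    rw [Matrix.det_fin_two]
    linear_combination (A 0 1 * A 0 1 + A 1 1 * A 1 1) * h00 + h11 - (A 0 0 * A 0 1 + A 1 0 * A 1 1) * h01
  constructor
  · simp [KAct, nsq, Matrix.mulVec, dotProduct, Fin.sum_univ_two]
    linear_combination (p.1 0) ^ 2 * h00 + (p.1 1) ^ 2 * h11 + 2 * p.1 0 * p.1 1 * h01 + (p.1 2) ^ 2 * hd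
  · simp only [KAct]
    linear_combination p.2 ^ 2 * hd

theorem ext3_smooth {g : V3 × ℝ → ℂ} (hg : ContDiff ℝ ∞ g) (hinv : InvK' g) (hR : PropertyR g) :
    ContDiff ℝ ∞ (ext3 g) := by
  rw [contDiff_iff_contDiffAt]
  rintro ⟨x0, y0⟩
  have n0 : ∀ y, 0 ≤ nsq y := fun y => by rw [nsq_eq]; positivity
  let r : ℝ := nsq x0 + nsq y0 + 1
  have hr : 0 < r := by have := n0 x0; have := n0 y0; simp only [r]; linarith
  let χ : ContDiffBump (0 : ℝ) := ⟨r, r + 1, hr, by linarith⟩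
  have χ1 : ∀ s, 0 ≤ s → s ≤ r → χ s = 1 := by
    intro s h0 h1
    refine χ.one_of_mem_closedBall ?_
    simp only [Metric.mem_closedBall, dist_zero_right, Real.norm_eq_abs, abs_of_nonneg h0]
    exact h1
  have χ0 : ∀ s, r + 1 ≤ s → χ s = 0 := by
    intro s h0
    apply χ.zero_of_le_dist
    simp only [dist_zero_right, Real.norm_eq_abs]; exact h0.trans (le_abs_self _)
  let g' : V3 × ℝ → ℂ := fun p => (χ (nsq p.1) : ℂ) * ((χ (p.2 ^ 2) : ℂ) * g p)
  have cχ : ContDiff ℝ ∞ (fun s : ℝ => (χ s : ℂ)) := Complex.ofRealCLM.contDiff.comp χ.contDiff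
  have cχn : ContDiff ℝ ∞ (fun x : V3 => (χ (nsq x) : ℂ)) := cχ.comp nsq_smooth
  have hg's : ContDiff ℝ ∞ g' :=
    (cχn.comp contDiff_fst).mul (((cχ.comp (contDiff_id.pow 2)).comp contDiff_snd).mul hg)
  have hg'c : HasCompactSupport g' := by
    refine HasCompactSupport.intro (isCompact_closedBall (0 : V3 × ℝ) (r + 1)) ?_
    rintro ⟨x, t⟩ hy
    simp only [Metric.mem_closedBall, dist_zero_right, not_le, Prod.norm_def, lt_max_iff] at hy
    rcases hy with h | h
    · have := le_nsq x
      simp only [g']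
      rw [χ0 (nsq x) (by nlinarith)]; simp
    · simp only [g']
      rw [χ0 (t ^ 2) (by rw [← sq_abs]; rw [Real.norm_eq_abs] at h; nlinarith)]; simp
  have hg'inv : InvK' g' := by
    intro A hA p
    obtain ⟨h1, h2⟩ := O2_facts hA p
    simp only [g', h1, h2, hinv A hA p]
  have hg'R : PropertyR g' := by
    intro M
    obtain ⟨P, hP, ⟨c, hc, hcP⟩, hres⟩ := hR M
    refine ⟨fun z => (χ (nsq z.1) : ℂ) * P z, ?_, ⟨fun m x => (χ (nsq x) : ℂ) * c m x, fun m => cχn.mul (hc m), ?_⟩, ?_⟩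
    · intro k hk x y
      simp only [nsq_rot hk, hP k hk]
    · intro x y
      simp only [hcP, Finset.mul_sum, mul_assoc]
    · intro x t
      simp only [hres]
      have h2 : (fun s => g' (x, s)) =ᶠ[nhds 0] fun s : ℝ => (χ (nsq x) : ℂ) * g (x, s) := by
        have : ∀ᶠ s : ℝ in nhds 0, s ^ 2 < r := by
          have hc : Continuous (fun s : ℝ => s ^ 2) := by fun_prop
          exact hc.tendsto' 0 0 (by simp) |>.eventually_lt_const hr
        filter_upwards [this] with s hs
        simp only [g']
        rw [χ1 (s ^ 2) (by positivity) hs.le]; simp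
      rw [← iteratedDeriv_eq_iterate, ← iteratedDeriv_eq_iterate, h2.iteratedDeriv_eq, iteratedDeriv_const_mul_field]
      ring
  have hS : IsS (ext3 g') := ext3_S (g := g') ⟨hg'c.toSchwartzMap hg's, rfl⟩ hg'R
  refine hS.smooth.contDiffAt.congr_of_eventuallyEq ?_
  have e1 : ∀ᶠ z : V3 × V3 in nhds (x0, y0), nsq z.1 < r :=
    ((nsq_smooth.continuous.comp continuous_fst).tendsto (x0, y0)).eventually_lt_const
      (by have := n0 y0; simp [r]; linarith)
  have e2 : ∀ᶠ z : V3 × V3 in nhds (x0, y0), nsq z.2 < r :=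
    ((nsq_smooth.continuous.comp continuous_snd).tendsto (x0, y0)).eventually_lt_const
      (by have := n0 x0; simp [r]; linarith)
  filter_upwards [e1, e2]
  rintro ⟨x, y⟩ h1 h2
  obtain ⟨k, hk, t, hkt⟩ := exists_rot' y
  rw [ext3_eq hinv (R_h0 hR) x y hk hkt, ext3_eq hg'inv (R_h0 hg'R) x y hk hkt]
  simp only [g']
  have ht : t ^ 2 = nsq y := by
    rw [← hkt, nsq_rot hk]; simp [nsq]
  rw [nsq_rot (SO3_transpose hk), ht, χ1 _ (n0 _) h1.le, χ1 _ (n0 _) h2.le]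
  simp

def cnt {M : ℕ} (σ : Fin M → Fin 3) (j : Fin 3) : ℕ := (Finset.univ.filter fun i => σ i = j).card

theorem cnt_sum {M : ℕ} (σ : Fin M → Fin 3) : cnt σ 0 + cnt σ 1 + cnt σ 2 = M := by
  have h := Finset.card_eq_sum_card_fiberwise (s := Finset.univ) (t := Finset.univ) (f := σ) (by simp [Set.MapsTo])
  rw [Fin.sum_univ_three] at h
  simp only [Finset.card_univ, Fintype.card_fin] at h
  exact h.symm

theorem cnt_prod {M : ℕ} (σ : Fin M → Fin 3) (y : V3) :
    ∏ i, y (σ i) = y 0 ^ cnt σ 0 * y 1 ^ cnt σ 1 * y 2 ^ cnt σ 2 := by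
  rw [← Finset.prod_fiberwise' Finset.univ σ y, Fin.prod_univ_three]
  simp only [Finset.prod_const, cnt]

theorem line_deriv {f : V3 × V3 → ℂ} (hf : ContDiff ℝ ∞ f) (p v : V3 × V3) (M : ℕ) :
    deriv^[M] (fun s : ℝ => f (p + s • v)) 0 = iteratedFDeriv ℝ M f p (fun _ => v) := by
  rw [← iteratedDeriv_eq_iterate, iteratedDeriv_eq_iteratedFDeriv]
  let L : ℝ →L[ℝ] V3 × V3 := (ContinuousLinearMap.id ℝ ℝ).smulRight v
  have e : (fun s : ℝ => f (p + s • v)) = (fun z => f (p + z)) ∘ L := rfl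
  have hs : ContDiff ℝ ∞ (fun z => f (p + z)) := hf.comp (contDiff_const.add contDiff_id)
  rw [e, L.iteratedFDeriv_comp_right hs 0 (by exact_mod_cast le_top)]
  rw [iteratedFDeriv_comp_add_left]
  simp [L]

theorem forward {f : V3 × V3 → ℂ} (hf : ContDiff ℝ ∞ f) (hinv : Inv3 f) {g : V3 × ℝ → ℂ}
    (hfg : ∀ (x : V3) (t : ℝ), f (x, ![0, 0, t]) = g (x, t)) : PropertyR g := by
  intro M
  have hsm : ContDiff ℝ ∞ (iteratedFDeriv ℝ M f) := hf.iteratedFDeriv_right (by first | rfl | exact le_of_eq rfl | exact_mod_cast le_top)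
  let e : Fin 3 → V3 × V3 := fun i => (0, Pi.single i 1)
  let d : (Fin M → Fin 3) → V3 → ℂ := fun σ x => iteratedFDeriv ℝ M f (x, 0) (fun i => e (σ i))
  have hd : ∀ σ, ContDiff ℝ ∞ (d σ) := by
    intro σ
    exact (ContinuousMultilinearMap.apply ℝ (fun _ : Fin M => V3 × V3) ℂ (fun i => e (σ i))).contDiff.comp
      (hsm.comp (contDiff_id.prodMk contDiff_const))
  refine ⟨fun z => (M.factorial : ℂ)⁻¹ * iteratedFDeriv ℝ M f (z.1, 0) (fun _ => (0, z.2)), ?_, ?_, ?_⟩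
  · intro k hk x y
    let k1 : V3 →L[ℝ] V3 := LinearMap.toContinuousLinearMap (Matrix.mulVecLin k)
    let K : V3 × V3 →L[ℝ] V3 × V3 := k1.prodMap k1
    have eK : f = f ∘ K := by
      funext ⟨a, b⟩
      exact (hinv k hk a b).symm
    have := K.iteratedFDeriv_comp_right hf (x, 0) (i := M) (by exact_mod_cast le_top)
    rw [← eK] at this
    simp only
    rw [this]
    have a1 : K (x, 0) = (k *ᵥ x, 0) := Prod.ext rfl (Matrix.mulVec_zero k)
    have a2 : K (0, y) = (0, k *ᵥ y) := Prod.ext (Matrix.mulVec_zero k) rfl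
    simp only [ContinuousMultilinearMap.compContinuousLinearMap_apply, a1, a2]
  · let ci : (Fin M → Fin 3) → ℕ × ℕ × ℕ := fun σ => (cnt σ 0, cnt σ 1, cnt σ 2)
    refine ⟨fun m x => (M.factorial : ℂ)⁻¹ * ∑ σ with ci σ = m, d σ x, fun m => ?_, fun x y => ?_⟩
    · exact contDiff_const.mul (ContDiff.sum fun σ _ => hd σ)
    · have h1 : (0, y) = ∑ j : Fin 3, y j • e j := by
        refine Prod.ext ?_ ?_
        · simp [e, Prod.fst_sum]
        · ext i; simp [e, Prod.snd_sum, Finset.sum_apply, Pi.single_apply]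
      simp only [h1]
      rw [ContinuousMultilinearMap.map_sum]
      simp only [ContinuousMultilinearMap.map_smul_univ]
      rw [← Finset.sum_fiberwise_of_maps_to (s := Finset.univ) (g := ci)
        (t := (Finset.range (M + 1) ×ˢ Finset.range (M + 1) ×ˢ Finset.range (M + 1)).filter
            (fun m => m.1 + m.2.1 + m.2.2 = M))]
      · rw [Finset.mul_sum]
        refine Finset.sum_congr rfl fun m _ => ?_
        simp only [mul_assoc]
        rw [Finset.sum_mul]
        congr 1
        refine Finset.sum_congr rfl fun σ hσ => ?_
        simp only [Finset.mem_filter, Finset.mem_univ, true_and] at hσ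
        subst hσ
        rw [cnt_prod, Complex.real_smul]
        simp only [d, ci]
        push_cast
        ring
      · intro σ _
        have := cnt_sum σ
        simp [ci]
        omega
  · intro x t
    have h1 : (fun s => g (x, s)) = fun s : ℝ => f ((x, 0) + s • ((0, ![0, 0, 1]) : V3 × V3)) := by
      funext s
      rw [← hfg]
      congr 1
      refine Prod.ext (by simp) ?_
      ext i; fin_cases i <;> simp
    rw [h1, line_deriv hf]
    have h2 : ((0, ![0, 0, t]) : V3 × V3) = t • (0, ![0, 0, 1]) := by
      refine Prod.ext (by simp) ?_
      ext i; fin_cases i <;> simp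
    simp only [h2]
    have := (iteratedFDeriv ℝ M f (x, 0)).map_smul_univ (fun _ => t) (fun _ => ((0, ![0, 0, 1]) : V3 × V3))
    rw [this, Complex.real_smul]
    simp
    ring

/-- A smooth `K'`-invariant function `g` on `ℝ³ × ℝ` is the restriction of a smooth
`SO(3)`-invariant function on `ℝ³ × ℝ³` iff it satisfies Property (R); moreover if `g` is
Schwartz then the extension can be chosen Schwartz. -/
theorem statement6 (g : V3 × ℝ → ℂ) (hg : ContDiff ℝ (⊤ : ℕ∞) g) (hinv : InvK' g) :
    ((∃ f : V3 × V3 → ℂ, ContDiff ℝ (⊤ : ℕ∞) f ∧ Inv3 f ∧ ∀ (x : V3) (t : ℝ), f (x, ![0, 0, t]) = g (x, t))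
      ↔ PropertyR g) ∧
    (PropertyR g → (∃ G : SchwartzMap (V3 × ℝ) ℂ, ⇑G = g) →
      ∃ F : SchwartzMap (V3 × V3) ℂ, Inv3 ⇑F ∧ ∀ (x : V3) (t : ℝ), F (x, ![0, 0, t]) = g (x, t)) := by
  refine ⟨⟨?_, ?_⟩, ?_⟩
  · rintro ⟨f, hf, hfi, hfg⟩
    exact forward hf hfi hfg
  · intro hR
    exact ⟨ext3 g, ext3_smooth hg hinv hR, ext3_inv hinv (R_h0 hR), ext3_restrict hinv (R_h0 hR)⟩
  · intro hR hG
    obtain ⟨F, hF⟩ := ext3_S hG hR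
    refine ⟨F, ?_, ?_⟩
    · rw [hF]; exact ext3_inv hinv (R_h0 hR)
    · rw [hF]; exact ext3_restrict hinv (R_h0 hR)
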